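/- arXiv:1703.01126 — 4 statements merged into one kernel-verified Lean document; each statement's English description precedes it below -/
import Mathlib

section
/- Let n ≥ 2 and let ξ_1, …, ξ_{n-1} be (not necessarily distinct) points in the open unit disc 𝔻. Then there exists a finite Blaschke product B of degree n whose critical points in 𝔻 are precisely ξ_1, …, ξ_{n-1} counted with multiplicity; concretely, there exist a_1, …, a_n ∈ 𝔻, a constant c with |c| = 1, and a nonzero complex constant c' such that B(z) = c·∏_{k=1}^n (z - a_k)/(1 - conj(a_k)·z) satisfies B'(z)·∏_{k=1}^n (1 - conj(a_k)·z)² = c'·∏_{j=1}^{n-1} (z - ξ_j)(1 - conj(ξ_j)·z) for all z ∈ ℂ where B is defined. -/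
open Complex ComplexConjugate Finset

namespace BlaschkeAux
open Polynomial Filter Topology

lemma hasDerivAt_line (F G : ℂ[X]) (z0 e : ℂ) (t : ℝ) :
    HasDerivAt (fun t : ℝ => F.eval (z0 + t * e) * conj (G.eval (z0 + t * e)))
      (e * (derivative F).eval (z0 + t * e) * conj (G.eval (z0 + t * e)) +
        conj e * (F.eval (z0 + t * e) * conj ((derivative G).eval (z0 + t * e)))) t := by
  have hl : HasDerivAt (fun t : ℝ => z0 + (t : ℂ) * e) e t := by
    have := ((Complex.ofRealCLM.hasDerivAt (x := t)).mul_const e).const_add z0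
    simpa using this
  have h1 (F : ℂ[X]) : HasDerivAt (fun t : ℝ => F.eval (z0 + (t : ℂ) * e))
      ((derivative F).eval (z0 + t * e) * e) t :=
    HasDerivAt.comp (h₂ := fun z => F.eval z) t (F.hasDerivAt (z0 + t * e)) hl
  have h2 : HasDerivAt (fun t : ℝ => conj (G.eval (z0 + (t : ℂ) * e)))
      (conj ((derivative G).eval (z0 + t * e) * e)) t := (h1 G).star
  refine ((h1 F).mul h2).congr_deriv ?_
  simp only [map_mul]; ring

lemma hasDerivAt_sum {ι : Type*} [Fintype ι] (F G : ι → ℂ[X]) (z0 e : ℂ) (t : ℝ) :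
    HasDerivAt (fun t : ℝ => ∑ k, (F k).eval (z0 + t * e) * conj ((G k).eval (z0 + t * e)))
      (e * ∑ k, (derivative (F k)).eval (z0 + t * e) * conj ((G k).eval (z0 + t * e)) +
        conj e * ∑ k, ((F k).eval (z0 + t * e) * conj ((derivative (G k)).eval (z0 + t * e)))) t := by
  have := HasDerivAt.fun_sum (u := Finset.univ) (fun k _ => hasDerivAt_line (F k) (G k) z0 e t)
  refine this.congr_deriv ?_
  rw [Finset.mul_sum, Finset.mul_sum, ← Finset.sum_add_distrib]
  refine Finset.sum_congr rfl fun k _ => by ring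

lemma hasDerivAt_re {f : ℝ → ℂ} {f' : ℂ} {t : ℝ} (h : HasDerivAt f f' t) :
    HasDerivAt (fun t => (f t).re) f'.re t :=
  (Complex.reCLM.hasFDerivAt.comp_hasDerivAt t h)

/-- first-order and second-order conditions at a local max -/
lemma localMax_conditions {ι : Type*} [Fintype ι] (F G : ι → ℂ[X]) (z0 : ℂ)
    (h : IsLocalMax (fun z : ℂ => (∑ k, (F k).eval z * conj ((G k).eval z)).re) z0) :
    (∑ k, ((derivative (F k)).eval z0 * conj ((G k).eval z0) +
        conj ((F k).eval z0) * (derivative (G k)).eval z0) = 0) ∧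
    (∑ k, (derivative (F k)).eval z0 * conj ((derivative (G k)).eval z0)).re ≤ 0 := by
  have hline (e : ℂ) : IsLocalMax (fun t : ℝ => (∑ k, (F k).eval (z0 + t * e) *
      conj ((G k).eval (z0 + t * e))).re) 0 := by
    have hc : ContinuousAt (fun t : ℝ => z0 + (t : ℂ) * e) 0 := by fun_prop
    have h' : Tendsto (fun t : ℝ => z0 + (t : ℂ) * e) (𝓝 0) (𝓝 z0) := by
      have := hc.tendsto; simpa using this
    have := h'.eventually h
    show ∀ᶠ t in 𝓝 (0:ℝ), _
    filter_upwards [this] with t ht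
    simpa using ht
  have hd (e : ℂ) (t : ℝ) := hasDerivAt_re (hasDerivAt_sum F G z0 e t)
  constructor
  · set A := ∑ k, (derivative (F k)).eval z0 * conj ((G k).eval z0) with hA
    set B := ∑ k, ((F k).eval z0 * conj ((derivative (G k)).eval z0)) with hB
    have h0 (e : ℂ) : (e * A + conj e * B).re = 0 := by
      have := (hline e).hasDerivAt_eq_zero (hd e 0)
      simpa [hA, hB] using this
    have h1 := h0 1
    have h2 := h0 I
    have : ∑ k, ((derivative (F k)).eval z0 * conj ((G k).eval z0) +
        conj ((F k).eval z0) * (derivative (G k)).eval z0) = A + conj B := by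
      rw [Finset.sum_add_distrib, hB, map_sum]; simp [hA]
    rw [this]
    apply Complex.ext
    · simpa using h1
    · simp at h2 ⊢; linarith
  · by_contra hpos
    push Not at hpos
    set φ : ℝ → ℝ := fun t => (∑ k, (F k).eval (z0 + t * 1) *
      conj ((G k).eval (z0 + t * 1))).re + (∑ k, (F k).eval (z0 + t * I) *
      conj ((G k).eval (z0 + t * I))).re with hφ
    have hmax : IsLocalMax φ 0 := (hline 1).add (hline I)
    have hφ' : deriv φ = fun t : ℝ => _ := funext fun t => ((hd 1 t).add (hd I t)).deriv
    have hd2 (e : ℂ) (t : ℝ) := hasDerivAt_re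
      (((hasDerivAt_sum (fun k => derivative (F k)) G z0 e t).const_mul e).add
      ((hasDerivAt_sum F (fun k => derivative (G k)) z0 e t).const_mul (conj e)))
    have hφ'' : deriv (deriv φ) 0 = 4 * (∑ k, (derivative (F k)).eval z0 *
        conj ((derivative (G k)).eval z0)).re := by
      rw [hφ']
      refine (((hd2 1 0).add (hd2 I 0)).deriv).trans ?_
      simp
      ring
    have hmin : IsLocalMin φ 0 := by
      apply isLocalMin_of_deriv_deriv_pos
      · rw [hφ'']; linarith
      · exact hmax.deriv_eq_zero
      · exact ((hd 1 0).add (hd I 0)).continuousAt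
    have heq : φ =ᶠ[𝓝 0] fun _ => φ 0 := by
      filter_upwards [hmax, hmin] with t h1 h2 using le_antisymm h1 h2
    have := heq.deriv.deriv_eq
    rw [hφ''] at this
    simp at this
    simp at hpos
    linarith

/-- differentiate an identity `∑ F conj G = 0` in `z`. -/
lemma sum_eq_zero_deriv {ι : Type*} [Fintype ι] (F G : ι → ℂ[X])
    (h : ∀ z : ℂ, ‖z‖ < 1 → ∑ k, (F k).eval z * conj ((G k).eval z) = 0) :
    ∀ z : ℂ, ‖z‖ < 1 → ∑ k, (derivative (F k)).eval z * conj ((G k).eval z) = 0 := by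
  intro z0 hz0
  have hd (e : ℂ) := hasDerivAt_sum F G z0 e 0
  have hz (e : ℂ) : (fun t : ℝ => ∑ k, (F k).eval (z0 + t * e) * conj ((G k).eval (z0 + t * e)))
      =ᶠ[𝓝 0] fun _ => 0 := by
    have hc : ContinuousAt (fun t : ℝ => ‖z0 + (t : ℂ) * e‖) 0 := by fun_prop
    have := hc.eventually_lt (continuousAt_const (y := (1:ℝ))) (by simpa using hz0)
    filter_upwards [this] with t ht using h _ ht
  have h0 (e : ℂ) := (hd e).unique ((hasDerivAt_const (0:ℝ) (0:ℂ)).congr_of_eventuallyEq (hz e))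
  have h1 := h0 1
  have h2 := h0 I
  simp only [map_one, conj_I, ofReal_zero, zero_mul, add_zero] at h1 h2
  have : (2 : ℂ) * ∑ k, (derivative (F k)).eval z0 * conj ((G k).eval z0) = 0 := by
    linear_combination h1 - I * h2 + (∑ k, (derivative (F k)).eval z0 * conj ((G k).eval z0) -
      ∑ k, (F k).eval z0 * conj ((derivative (G k)).eval z0)) * I_sq
  simpa using this

end BlaschkeAux

namespace BlaschkeAux
open Polynomial Filter Topology

noncomputable def Mf (P S Q T : ℂ[X]) (z : ℂ) : ℝ :=
  2 * (T.eval z * conj (S.eval z) - Q.eval z * conj (P.eval z)).re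

noncomputable def Mz (P S Q T : ℂ[X]) (z : ℂ) : ℂ :=
  (derivative T).eval z * conj (S.eval z) + (derivative S).eval z * conj (T.eval z)
    - (derivative Q).eval z * conj (P.eval z) - (derivative P).eval z * conj (Q.eval z)

noncomputable def Nf (P S : ℂ[X]) (z : ℂ) : ℝ := ‖S.eval z‖ ^ 2 - ‖P.eval z‖ ^ 2

lemma continuous_conj_eval (P : ℂ[X]) : Continuous fun z => conj (P.eval z) :=
  Complex.continuous_conj.comp P.continuous

lemma continuous_Mf (P S Q T : ℂ[X]) : Continuous (Mf P S Q T) := by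
  have h1 := continuous_conj_eval P
  have h2 := continuous_conj_eval S
  unfold Mf
  exact continuous_const.mul (Complex.continuous_re.comp
    ((T.continuous.mul h2).sub (Q.continuous.mul h1)))

lemma continuous_Nf (P S : ℂ[X]) : Continuous (Nf P S) := by
  unfold Nf; fun_prop

lemma continuous_Mz (P S Q T : ℂ[X]) : Continuous (Mz P S Q T) := by
  have h1 := continuous_conj_eval P
  have h2 := continuous_conj_eval S
  have h3 := continuous_conj_eval Q
  have h4 := continuous_conj_eval T
  unfold Mz
  fun_prop

lemma hasDerivAt_Mf (P S Q T : ℂ[X]) (e : ℂ) (t : ℝ) :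
    HasDerivAt (fun t : ℝ => Mf P S Q T (t * e)) (2 * (e * Mz P S Q T (t * e)).re) t := by
  have h := hasDerivAt_re (hasDerivAt_sum ![2 * T, -2 * Q] ![S, P] 0 e t)
  simp only [zero_add, Fin.sum_univ_two] at h
  refine (h.congr_deriv ?_).congr_of_eventuallyEq (Eventually.of_forall fun s => ?_)
  · simp [Mz]; ring
  · simp [Mf]; ring

lemma circle_zero {n : ℕ} (P S Q T : ℂ[X])
    (hS : ∀ z : ℂ, ‖z‖ = 1 → S.eval z = z ^ n * conj (P.eval z))
    (hT : ∀ z : ℂ, ‖z‖ = 1 → T.eval z = z ^ n * conj (Q.eval z))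
    (hW : derivative Q * S - Q * derivative S + derivative P * T - P * derivative T = 0)
    (z : ℂ) (hz : ‖z‖ = 1) : Mf P S Q T z = 0 ∧ Mz P S Q T z = 0 := by
  have hzz : z * conj z = 1 := by rw [Complex.mul_conj, Complex.normSq_eq_norm_sq, hz]; simp
  have hzn : z ^ n * conj z ^ n = 1 := by rw [← mul_pow, hzz, one_pow]
  have e1 : conj (S.eval z) = conj z ^ n * P.eval z := by rw [hS z hz]; simp
  have e2 : conj (T.eval z) = conj z ^ n * Q.eval z := by rw [hT z hz]; simp
  have e3 : conj (P.eval z) = conj z ^ n * S.eval z := by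
    rw [hS z hz]; linear_combination (-conj (P.eval z)) * hzn
  have e4 : conj (Q.eval z) = conj z ^ n * T.eval z := by
    rw [hT z hz]; linear_combination (-conj (Q.eval z)) * hzn
  constructor
  · have : (Mf P S Q T z : ℂ) = T.eval z * conj (S.eval z) - Q.eval z * conj (P.eval z) +
        conj (T.eval z * conj (S.eval z) - Q.eval z * conj (P.eval z)) := by
      rw [Complex.add_conj]; simp [Mf]
    rw [← Complex.ofReal_eq_zero, this]
    simp only [map_sub, map_mul, Complex.conj_conj]
    rw [e1, e2, e3, e4]; ring
  · have h := congrArg (Polynomial.eval z) hW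
    simp only [eval_add, eval_sub, eval_mul, eval_zero] at h
    unfold Mz
    rw [e1, e2, e3, e4]
    linear_combination (-conj z ^ n) * h

lemma boundary {n : ℕ} (P S Q T : ℂ[X])
    (hS : ∀ z : ℂ, ‖z‖ = 1 → S.eval z = z ^ n * conj (P.eval z))
    (hT : ∀ z : ℂ, ‖z‖ = 1 → T.eval z = z ^ n * conj (Q.eval z))
    (hW : derivative Q * S - Q * derivative S + derivative P * T - P * derivative T = 0)
    (η : ℝ) (hη : 0 < η) :
    ∃ ρ : ℝ, ρ < 1 ∧ ∀ z : ℂ, ρ < ‖z‖ → ‖z‖ < 1 → |Mf P S Q T z| ≤ η * (1 - ‖z‖) := by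
  have hc := circle_zero P S Q T hS hT hW
  have huc := (isCompact_closedBall (0:ℂ) 1).uniformContinuousOn_of_continuous
    (continuous_Mz P S Q T).continuousOn
  rw [Metric.uniformContinuousOn_iff] at huc
  obtain ⟨δ, hδ, h⟩ := huc (η / 2) (by positivity)
  refine ⟨max 0 (1 - δ), by simp [hδ], fun z hz1 hz2 => ?_⟩
  have hz0 : 0 < ‖z‖ := lt_of_le_of_lt (le_max_left _ _) hz1
  have hzδ : 1 - δ < ‖z‖ := lt_of_le_of_lt (le_max_right _ _) hz1
  set e : ℂ := z / ‖z‖ with he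
  have hne : (‖z‖ : ℂ) ≠ 0 := by exact_mod_cast hz0.ne'
  have hen : ‖e‖ = 1 := by rw [he]; simp [hz0.ne']
  have hez : (‖z‖ : ℂ) * e = z := by rw [he]; field_simp
  have hb : ∀ t ∈ Set.Icc ‖z‖ 1, ‖2 * (e * Mz P S Q T (t * e)).re‖ ≤ η := by
    rintro t ⟨ht1, ht2⟩
    have ht0 : 0 ≤ t := hz0.le.trans ht1
    have h1 := h (t * e) (by simp [hen, abs_of_nonneg ht0, ht2]) e (by simp [hen]) (by
      rw [dist_eq_norm, show (t:ℂ) * e - e = ((t - 1 : ℝ) : ℂ) * e by push_cast; ring, norm_mul, hen,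
        Complex.norm_real, Real.norm_eq_abs, abs_of_nonpos (by linarith)]
      linarith)
    rw [dist_eq_norm, (hc e hen).2, sub_zero] at h1
    have h2 := Complex.abs_re_le_norm (e * Mz P S Q T (t * e))
    rw [norm_mul, hen, one_mul] at h2
    rw [norm_mul, Real.norm_eq_abs, Real.norm_eq_abs]
    rw [abs_two]
    linarith
  have := (convex_Icc ‖z‖ 1).norm_image_sub_le_of_norm_hasDerivWithin_le
    (fun t _ => (hasDerivAt_Mf P S Q T e t).hasDerivWithinAt) hb
    (Set.right_mem_Icc.2 hz2.le) (Set.left_mem_Icc.2 hz2.le)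
  rw [hez] at this
  simp only [ofReal_one, one_mul, (hc e hen).1, sub_zero, Real.norm_eq_abs] at this
  rwa [abs_of_nonpos (by linarith : ‖z‖ - 1 ≤ 0), neg_sub] at this

lemma max_alg (P S Q T : ℂ[X])
    (hW : derivative Q * S - Q * derivative S + derivative P * T - P * derivative T = 0)
    (z0 : ℂ) (c ε : ℝ) (hε : 0 < ε) (hN : 0 < Nf P S z0) (hδ : 0 < c - ε * ‖z0‖ ^ 2)
    (h0 : Mf P S Q T z0 = (c - ε * ‖z0‖ ^ 2) * Nf P S z0)
    (hmax : ∀ᶠ z in 𝓝 z0, Mf P S Q T z ≤ (c - ε * ‖z‖ ^ 2) * Nf P S z) : False := by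
  set F : Fin 6 → ℂ[X] := ![2 * T, -2 * Q, - C (c:ℂ) * S, C (c:ℂ) * P, C (ε:ℂ) * (X * S),
    - C (ε:ℂ) * (X * P)] with hF
  set G : Fin 6 → ℂ[X] := ![S, P, S, P, X * S, X * P] with hG
  have hH (z : ℂ) : (∑ k, (F k).eval z * conj ((G k).eval z)).re =
      Mf P S Q T z - (c - ε * ‖z‖ ^ 2) * Nf P S z := by
    simp only [hF, hG, Fin.sum_univ_six, Mf, Nf, ← Complex.normSq_eq_norm_sq, Complex.normSq_apply]
    simp
    ring
  have hlm : IsLocalMax (fun z : ℂ => (∑ k, (F k).eval z * conj ((G k).eval z)).re) z0 := by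
    filter_upwards [hmax] with z hz
    rw [hH, hH, h0]; linarith
  obtain ⟨h1, h2⟩ := localMax_conditions F G z0 hlm
  set H2 := ∑ k, (derivative (F k)).eval z0 * conj ((derivative (G k)).eval z0) with hH2
  have h3 := congrArg (Polynomial.eval z0) hW
  simp only [eval_add, eval_sub, eval_mul, eval_zero] at h3
  have h3c := congrArg conj h3
  have h1c := congrArg conj h1
  have h0' : T.eval z0 * conj (S.eval z0) + S.eval z0 * conj (T.eval z0)
     - Q.eval z0 * conj (P.eval z0) - P.eval z0 * conj (Q.eval z0) = (c - ε * (z0 * conj z0)) *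
       (S.eval z0 * conj (S.eval z0) - P.eval z0 * conj (P.eval z0)) := by
    have := congrArg (fun x : ℝ => (x : ℂ)) h0
    simp only [Mf, Nf, ← Complex.normSq_eq_norm_sq] at this
    push_cast [← Complex.mul_conj] at this
    rw [← this, ← Complex.ofReal_ofNat, ← Complex.ofReal_mul, ← Complex.add_conj]
    simp; ring
  set W := (derivative P).eval z0 * S.eval z0 - P.eval z0 * (derivative S).eval z0 with hWd
  have key : ((Nf P S z0 : ℝ) : ℂ) * (H2 + conj H2) = 
     ((2 * (2 * (c - ε * ‖z0‖ ^ 2) * ‖W‖ ^ 2 + ε * Nf P S z0 ^ 2) : ℝ) : ℂ) := by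
    simp only [hH2, hF, hG, Fin.sum_univ_six, Nf, hWd, ← Complex.normSq_eq_norm_sq] at h1 h1c ⊢
    push_cast [← Complex.mul_conj]
    have two : (starRingEnd ℂ) 2 = 2 := map_ofNat _ 2
    simp [two] at h1 h1c h3c ⊢
    generalize eval z0 P = p at *
    generalize eval z0 S = s at *
    generalize eval z0 Q = q at *
    generalize eval z0 T = t at *
    generalize eval z0 (derivative P) = p' at *
    generalize eval z0 (derivative S) = s' at *
    generalize eval z0 (derivative Q) = q' at *
    generalize eval z0 (derivative T) = t' at *
    generalize conj p = cp at *
    generalize conj s = cs at *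
    generalize conj q = cq at *
    generalize conj t = ct at *
    generalize conj p' = cp' at *
    generalize conj s' = cs' at *
    generalize conj q' = cq' at *
    generalize conj t' = ct' at *
    generalize conj z0 = cz at *
    clear_value W
    linear_combination (-2 * (s' * cs' - p' * cp')) * h0' + (s' * cs - p' * cp) * h1c + (s * cs' - p * cp') * h1 - 2 * (p' * s - p * s') * h3c - 2 * (cp' * cs - cp * cs') * h3
  have h4 : Nf P S z0 * (2 * H2.re) = 
      2 * (2 * (c - ε * ‖z0‖ ^ 2) * ‖W‖ ^ 2 + ε * Nf P S z0 ^ 2) := by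
    rw [Complex.add_conj] at key
    exact_mod_cast key
  have : 0 < Nf P S z0 * (2 * H2.re) := by rw [h4]; positivity
  nlinarith

/-- maximum principle -/
lemma Mf_nonpos {n : ℕ} (P S Q T : ℂ[X])
    (hS : ∀ z : ℂ, ‖z‖ = 1 → S.eval z = z ^ n * conj (P.eval z))
    (hT : ∀ z : ℂ, ‖z‖ = 1 → T.eval z = z ^ n * conj (Q.eval z))
    (hW : derivative Q * S - Q * derivative S + derivative P * T - P * derivative T = 0)
    (κ : ℝ) (hκ : 0 < κ) (hN : ∀ z : ℂ, ‖z‖ < 1 → κ * (1 - ‖z‖) ≤ Nf P S z)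
    (z : ℂ) (hz : ‖z‖ < 1) : Mf P S Q T z ≤ 0 := by
  by_contra hpos
  push Not at hpos
  have hNp (z : ℂ) (hz : ‖z‖ < 1) : 0 < Nf P S z :=
    lt_of_lt_of_le (mul_pos hκ (by linarith)) (hN z hz)
  set δ := Mf P S Q T z / Nf P S z with hδ
  have hδ0 : 0 < δ := div_pos hpos (hNp z hz)
  obtain ⟨ρ', hρ', hb⟩ := boundary P S Q T hS hT hW (κ * (δ / 2)) (by positivity)
  obtain ⟨ρ, hρ1, hρ2⟩ := exists_between (max_lt hz hρ')
  have hρz : ‖z‖ < ρ := lt_of_le_of_lt (le_max_left _ _) hρ1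
  have hρρ : ρ' < ρ := lt_of_le_of_lt (le_max_right _ _) hρ1
  set g : ℂ → ℝ := fun w => Mf P S Q T w / Nf P S w + δ / 4 * ‖w‖ ^ 2 with hg
  have hgc : ContinuousOn g (Metric.closedBall 0 ρ) := by
    refine ContinuousOn.add ((continuous_Mf P S Q T).continuousOn.div
      (continuous_Nf P S).continuousOn fun w hw => (hNp w ?_).ne') (by fun_prop)
    simp at hw; linarith
  obtain ⟨z0, hz0, hm⟩ := (isCompact_closedBall (0:ℂ) ρ).exists_isMaxOn
    ⟨z, by simp [hρz.le]⟩ hgc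
  simp at hz0
  have hgz : δ ≤ g z0 := by
    have : g z ≤ g z0 := hm (by simp [hρz.le])
    have h2 : δ ≤ g z := by simp only [hg]; rw [← hδ]; nlinarith [sq_nonneg ‖z‖]
    linarith
  have hz01 : ‖z0‖ < 1 := by linarith
  have hint : ‖z0‖ < ρ := by
    rcases hz0.lt_or_eq with h | h
    · exact h
    · exfalso
      have h1 := hb z0 (by linarith) hz01
      have h2 : Mf P S Q T z0 / Nf P S z0 ≤ δ / 2 := by
        rw [div_le_iff₀ (hNp z0 hz01)]
        have := hN z0 hz01
        have h3 := le_abs_self (Mf P S Q T z0)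
        nlinarith
      have h4 : ‖z0‖ ^ 2 ≤ 1 := by nlinarith [norm_nonneg z0]
      simp only [hg] at hgz
      nlinarith
  refine max_alg P S Q T hW z0 (g z0) (δ / 4) (by positivity) (hNp z0 hz01) ?_ ?_ ?_
  · have h4 : ‖z0‖ ^ 2 ≤ 1 := by nlinarith [norm_nonneg z0]
    nlinarith
  · have := (hNp z0 hz01).ne'
    simp only [hg]; field_simp; ring
  · have : Metric.ball (0:ℂ) ρ ∈ 𝓝 z0 := Metric.isOpen_ball.mem_nhds (by simpa using hint)
    filter_upwards [this] with w hw
    have hw' : ‖w‖ < ρ := by simpa using hw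
    have h5 : g w ≤ g z0 := hm (by simp [hw'.le])
    have hp := hNp w (by linarith)
    rw [← div_le_iff₀ hp]
    simp only [hg] at h5 ⊢
    linarith

lemma Mf_zero {n : ℕ} (P S Q T : ℂ[X])
    (hS : ∀ z : ℂ, ‖z‖ = 1 → S.eval z = z ^ n * conj (P.eval z))
    (hT : ∀ z : ℂ, ‖z‖ = 1 → T.eval z = z ^ n * conj (Q.eval z))
    (hW : derivative Q * S - Q * derivative S + derivative P * T - P * derivative T = 0)
    (κ : ℝ) (hκ : 0 < κ) (hN : ∀ z : ℂ, ‖z‖ < 1 → κ * (1 - ‖z‖) ≤ Nf P S z)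
    (z : ℂ) (hz : ‖z‖ < 1) : Mf P S Q T z = 0 := by
  apply le_antisymm (Mf_nonpos P S Q T hS hT hW κ hκ hN z hz)
  have := Mf_nonpos P S (-Q) (-T) hS (fun z hz => by simp [hT z hz])
    (by simp only [derivative_neg]; linear_combination -hW) κ hκ hN z hz
  simp [Mf] at this ⊢
  linarith

/-- injectivity -/
lemma T_eq_zero {n : ℕ} (P S Q T : ℂ[X])
    (hS : ∀ z : ℂ, ‖z‖ = 1 → S.eval z = z ^ n * conj (P.eval z))
    (hT : ∀ z : ℂ, ‖z‖ = 1 → T.eval z = z ^ n * conj (Q.eval z))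
    (hW : derivative Q * S - Q * derivative S + derivative P * T - P * derivative T = 0)
    (κ : ℝ) (hκ : 0 < κ) (hN : ∀ z : ℂ, ‖z‖ < 1 → κ * (1 - ‖z‖) ≤ Nf P S z)
    (hP0 : P.eval 0 = 0) (hQ0 : Q.eval 0 = 0) (r t : ℝ) (hr : S.eval 0 = r) (hr0 : r ≠ 0)
    (ht : T.eval 0 = t) : T = 0 := by
  have hM := Mf_zero P S Q T hS hT hW κ hκ hN
  have h0 : t = 0 := by
    have := hM 0 (by simp)
    simp [Mf, hP0, hr, ht, hr0] at this
    exact this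
  have hj (j : ℕ) : ∀ z : ℂ, ‖z‖ < 1 → ∑ k, (derivative^[j] ((![T, S, -Q, -P] : Fin 4 → ℂ[X]) k)).eval z *
      conj (((![S, T, P, Q] : Fin 4 → ℂ[X]) k).eval z) = 0 := by
    induction j with
    | zero =>
      intro z hz
      have := hM z hz
      rw [← Complex.ofReal_eq_zero, Mf, Complex.ofReal_mul, Complex.ofReal_ofNat] at this
      have h2 := Complex.add_conj (T.eval z * conj (S.eval z) - Q.eval z * conj (P.eval z))
      push_cast at h2
      rw [this] at h2
      simp [Fin.sum_univ_four] at h2 ⊢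
      linear_combination h2
    | succ j ih =>
      have := sum_eq_zero_deriv _ _ ih
      simpa only [Function.iterate_succ_apply'] using this
  ext j
  have := hj j 0 (by simp)
  simp [Fin.sum_univ_four, hP0, hQ0, hr, ht, h0, hr0] at this
  rw [← Polynomial.coeff_zero_eq_eval_zero, Polynomial.coeff_iterate_derivative] at this
  simp [Nat.descFactorial_self, Nat.factorial_ne_zero] at this
  simpa using this

end BlaschkeAux

namespace BlaschkeAux
open Polynomial Filter Topology

lemma circle_infinite : {z : ℂ | ‖z‖ = 1}.Infinite := by
  have h : IsPreconnected (Metric.sphere (0:ℂ) 1) :=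
    isPreconnected_sphere (by rw [Complex.rank_real_complex]; norm_num) 0 1
  have h2 : (Metric.sphere (0:ℂ) 1).Nontrivial :=
    ⟨1, by simp, -1, by simp, by norm_num [Complex.ext_iff]⟩
  have h3 := h.infinite_of_nontrivial h2
  have : {z : ℂ | ‖z‖ = 1} = Metric.sphere (0:ℂ) 1 := by ext; simp
  rwa [this]

lemma poly_eq_of_circle (F G : ℂ[X]) (h : ∀ z : ℂ, ‖z‖ = 1 → F.eval z = G.eval z) : F = G :=
  Polynomial.eq_of_infinite_eval_eq F G (circle_infinite.mono fun z hz => h z hz)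

lemma mul_conj_of_norm {z : ℂ} (hz : ‖z‖ = 1) : z * conj z = 1 := by
  rw [Complex.mul_conj, Complex.normSq_eq_norm_sq, hz]; simp

abbrev XX (m : ℕ) := (Fin m → ℂ) × ℝ

variable {m : ℕ}

def cf (x : XX m) (j : ℕ) : ℂ := if h : j < m then x.1 ⟨j, h⟩ else (x.2 : ℂ)

lemma cf_add (x y : XX m) (j : ℕ) : cf (x + y) j = cf x j + cf y j := by
  unfold cf; split_ifs <;> simp

lemma cf_smul (c : ℝ) (x : XX m) (j : ℕ) : cf (c • x) j = c * cf x j := by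
  unfold cf; split_ifs <;> simp

noncomputable def pp (x : XX m) : ℂ[X] := ∑ j ∈ range (m + 1), C (cf x j) * X ^ j

noncomputable def PP : XX m →ₗ[ℝ] ℂ[X] where
  toFun x := X * pp x
  map_add' x y := by
    simp only [pp, cf_add, C_add, add_mul, Finset.sum_add_distrib, mul_add]
  map_smul' c x := by
    simp only [pp, cf_smul, C_mul, RingHom.id_apply, Finset.mul_sum, Finset.smul_sum]
    refine Finset.sum_congr rfl fun j _ => ?_
    rw [show X * (C (c : ℂ) * C (cf x j) * X ^ j) = C (c : ℂ) * (X * (C (cf x j) * X ^ j)) by ring]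
    ext k
    simp only [coeff_C_mul, coeff_smul, Complex.real_smul]

noncomputable def SS : XX m →ₗ[ℝ] ℂ[X] where
  toFun x := ∑ j ∈ range (m + 1), C (conj (cf x j)) * X ^ (m - j)
  map_add' x y := by
    simp only [cf_add, map_add, add_mul, Finset.sum_add_distrib]
  map_smul' c x := by
    simp only [cf_smul, map_mul, RingHom.id_apply, Finset.smul_sum, conj_ofReal]
    refine Finset.sum_congr rfl fun j _ => ?_
    ext k
    simp [mul_assoc]

lemma PP_apply (x : XX m) : PP x = X * pp x := rfl
lemma SS_apply (x : XX m) : SS x = ∑ j ∈ range (m + 1), C (conj (cf x j)) * X ^ (m - j) := rfl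

lemma SS_eval' (x : XX m) (z w : ℂ) (h : z * w = 1) :
    (SS x).eval z = z ^ m * conj ((pp x).eval (conj w)) := by
  rw [SS_apply, pp]
  simp only [eval_finsetSum, eval_mul, eval_C, eval_pow, eval_X, map_sum, map_mul, map_pow,
    conj_conj, Finset.mul_sum]
  refine Finset.sum_congr rfl fun j hj => ?_
  have hj : j ≤ m := by simp at hj; omega
  have : z ^ m * w ^ j = z ^ (m - j) := by
    conv_lhs => rw [← Nat.sub_add_cancel hj, pow_add, mul_assoc, ← mul_pow, h]
    simp
  linear_combination (-conj (cf x j)) * this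

lemma SS_eval (x : XX m) (z : ℂ) (hz : ‖z‖ = 1) :
    (SS x).eval z = z ^ m * conj ((pp x).eval z) := by
  have := SS_eval' x z (conj z) (mul_conj_of_norm hz)
  simpa using this

lemma SS_eval_P (x : XX m) (z : ℂ) (hz : ‖z‖ = 1) :
    (SS x).eval z = z ^ (m + 1) * conj ((PP x).eval z) := by
  rw [SS_eval x z hz, PP_apply, eval_mul, eval_X, map_mul, pow_succ]
  linear_combination (-z ^ m * conj ((pp x).eval z)) * mul_conj_of_norm hz

lemma SS_deriv_eval (x : XX m) (z : ℂ) (hz : ‖z‖ = 1) :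
    z * (derivative (SS x)).eval z = z ^ m * (m * conj ((pp x).eval z) -
      conj (z * (derivative (pp x)).eval z)) := by
  have hzz := mul_conj_of_norm hz
  rw [SS_apply, pp]
  simp only [eval_finsetSum, derivative_C_mul_X_pow,
    eval_mul, eval_C, eval_pow, eval_X, map_sum, map_mul, map_pow,
    Finset.mul_sum]
  rw [← Finset.sum_sub_distrib, Finset.mul_sum]
  refine Finset.sum_congr rfl fun j hj => ?_
  have hj : j ≤ m := by simp at hj; omega
  have : z ^ m * conj z ^ j = z ^ (m - j) := by
    conv_lhs => rw [← Nat.sub_add_cancel hj, pow_add, mul_assoc, ← mul_pow, hzz]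
    simp
  have e1 : (((m - j : ℕ) : ℂ)) * (z * z ^ (m - j - 1)) = (m - j) * z ^ (m - j) := by
    rcases Nat.eq_zero_or_pos (m - j) with h | h
    · have : m = j := by omega
      subst this; simp
    · rw [← pow_succ', Nat.sub_add_cancel h, Nat.cast_sub hj]
  have e2 : ((j : ℕ) : ℂ) * (conj z * conj z ^ (j - 1)) = j * conj z ^ j := by
    rcases Nat.eq_zero_or_pos j with h | h
    · subst h; simp
    · rw [← pow_succ', Nat.sub_add_cancel h]
  simp only [map_natCast]
  linear_combination conj (cf x j) * e1 - (m - j) * conj (cf x j) * this +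
    z ^ m * conj (cf x j) * e2

noncomputable def Wp (x : XX m) : ℂ[X] := derivative (PP x) * SS x - PP x * derivative (SS x)

noncomputable def dWp (x y : XX m) : ℂ[X] :=
  derivative (PP y) * SS x - PP y * derivative (SS x) + derivative (PP x) * SS y
    - PP x * derivative (SS y)

lemma dWp_eq (x y : XX m) : dWp x y = Wp (x + y) - Wp x - Wp y := by
  simp only [dWp, Wp, map_add]; ring

lemma Wp_real (x : XX m) (z : ℂ) (hz : ‖z‖ = 1) : ((Wp x).eval z * conj z ^ m).im = 0 := by
  have hzz := mul_conj_of_norm hz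
  have hzn : z ^ m * conj z ^ m = 1 := by rw [← mul_pow, hzz, one_pow]
  rw [← Complex.conj_eq_iff_im]
  have h1 := SS_eval x z hz
  have h2 := SS_deriv_eval x z hz
  set u := (pp x).eval z
  set v := (derivative (pp x)).eval z
  have : (Wp x).eval z * conj z ^ m = (1 - m) * (u * conj u) + (z * v * conj u + conj (z * v) * u) := by
    simp only [Wp, PP_apply, eval_sub, eval_mul, derivative_mul, derivative_X, eval_add, eval_X, one_mul]
    rw [h1]
    linear_combination (-u * conj z ^ m) * h2 + ((u + z * v) * conj u - u * (m * conj u - conj (z * v))) * hzn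
  rw [this]
  simp only [map_add, map_mul, map_sub, conj_conj, map_one, map_natCast]
  ring

lemma dWp_real (x y : XX m) (z : ℂ) (hz : ‖z‖ = 1) : ((dWp x y).eval z * conj z ^ m).im = 0 := by
  rw [dWp_eq]
  simp only [eval_sub, sub_mul, Complex.sub_im, Wp_real _ z hz]; simp

lemma natDegree_pp (x : XX m) : (pp x).natDegree ≤ m := by
  refine natDegree_sum_le_of_forall_le _ _ fun j hj => ?_
  refine (natDegree_C_mul_X_pow_le _ _).trans ?_
  simp at hj; omega

lemma natDegree_PP (x : XX m) : (PP x).natDegree ≤ m + 1 := by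
  rw [PP_apply]
  refine (natDegree_mul_le (p := (X : ℂ[X])) (q := pp x)).trans ?_
  have := natDegree_pp x
  have : (X : ℂ[X]).natDegree ≤ 1 := natDegree_X_le
  omega

lemma natDegree_SS (x : XX m) : (SS x).natDegree ≤ m := by
  rw [SS_apply]
  refine natDegree_sum_le_of_forall_le _ _ fun j hj => ?_
  refine (natDegree_C_mul_X_pow_le _ _).trans ?_
  omega

lemma natDegree_W1 (hm : 1 ≤ m) (x y : XX m) :
    (derivative (PP x) * SS y - PP x * derivative (SS y)).natDegree ≤ 2 * m := by
  have h1 := natDegree_PP x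
  have h2 := natDegree_SS y
  have h3 := natDegree_derivative_le (PP x)
  have h4 := natDegree_derivative_le (SS y)
  refine (natDegree_sub_le _ _).trans (max_le ?_ ?_)
  · refine natDegree_mul_le.trans ?_; omega
  · refine natDegree_mul_le.trans ?_; omega

lemma natDegree_dWp (hm : 1 ≤ m) (x y : XX m) : (dWp x y).natDegree ≤ 2 * m := by
  rw [dWp_eq]
  exact (natDegree_sub_le _ _).trans (max_le ((natDegree_sub_le _ _).trans
    (max_le (natDegree_W1 hm _ _) (natDegree_W1 hm _ _))) (natDegree_W1 hm _ _))

lemma exists_points (m : ℕ) : ∃ ζ : Fin (2 * m + 1) → ℂ, Function.Injective ζ ∧ ∀ i, ‖ζ i‖ = 1 := by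
  have h := Complex.isPrimitiveRoot_exp (2 * m + 1) (by omega)
  refine ⟨fun i => _ ^ (i : ℕ), fun i j hij => Fin.ext (h.pow_inj i.2 j.2 hij), fun i => ?_⟩
  rw [norm_pow, norm_eq_one_of_pow_eq_one h.pow_eq_one (by omega), one_pow]

lemma poly_eq_of_points {ζ : Fin (2 * m + 1) → ℂ} (hζ : Function.Injective ζ) (F G : ℂ[X])
    (hF : F.natDegree ≤ 2 * m) (hG : G.natDegree ≤ 2 * m) (h : ∀ i, F.eval (ζ i) = G.eval (ζ i)) :
    F = G := by
  rw [← sub_eq_zero]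
  refine Polynomial.eq_zero_of_natDegree_lt_card_of_eval_eq_zero (F - G) hζ (fun i => by simp [h i]) ?_
  simp
  have := (natDegree_sub_le F G).trans (max_le hF hG)
  omega

noncomputable def ff (ζ : Fin (2 * m + 1) → ℂ) (x : XX m) : Fin (2 * m + 1) → ℝ :=
  fun i => ((Wp x).eval (ζ i) * conj (ζ i) ^ m).re

noncomputable def ev (L : XX m →ₗ[ℝ] ℂ[X]) (z : ℂ) : XX m →L[ℝ] ℂ :=
  LinearMap.toContinuousLinearMap (((Polynomial.leval z).restrictScalars ℝ).comp L)

lemma ev_apply (L : XX m →ₗ[ℝ] ℂ[X]) (z : ℂ) (x : XX m) : ev L z x = (L x).eval z := rfl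

noncomputable def dd : ℂ[X] →ₗ[ℝ] ℂ[X] := (derivative (R := ℂ)).restrictScalars ℝ

lemma ff_strict (ζ : Fin (2 * m + 1) → ℂ) (x : XX m) :
    ∃ f' : XX m →L[ℝ] (Fin (2 * m + 1) → ℝ), HasStrictFDerivAt (ff ζ) f' x ∧
      ∀ y i, f' y i = ((dWp x y).eval (ζ i) * conj (ζ i) ^ m).re := by
  have h (i : Fin (2 * m + 1)) : ∃ g : XX m →L[ℝ] ℝ, HasStrictFDerivAt (fun x => ff ζ x i) g x ∧
      ∀ y, g y = ((dWp x y).eval (ζ i) * conj (ζ i) ^ m).re := by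
    have h1 := (ev (dd.comp PP) (ζ i)).hasStrictFDerivAt (x := x)
    have h2 := (ev SS (ζ i)).hasStrictFDerivAt (x := x)
    have h3 := (ev PP (ζ i)).hasStrictFDerivAt (x := x)
    have h4 := (ev (dd.comp SS) (ζ i)).hasStrictFDerivAt (x := x)
    have h5 := (((h1.mul h2).sub (h3.mul h4)).mul_const (conj (ζ i) ^ m))
    have h6 := Complex.reCLM.hasStrictFDerivAt.comp x h5
    refine ⟨_, h6.congr_of_eventuallyEq (Eventually.of_forall fun y => ?_), fun y => ?_⟩
    · simp [ff, Wp, ev_apply, dd]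
    · simp only [ContinuousLinearMap.comp_apply, Complex.reCLM_apply]
      congr 1
      simp [dWp, ev_apply, dd]
      ring
  choose g hg1 hg2 using h
  exact ⟨ContinuousLinearMap.pi g, hasStrictFDerivAt_pi.2 hg1, fun y i => by simp [hg2]⟩

lemma SS_zero (x : XX m) : (SS x).eval 0 = x.2 := by
  rw [SS_apply, eval_finsetSum, Finset.sum_eq_single m]
  · simp [cf]
  · intro j hj hjm
    have : m - j ≠ 0 := by simp at hj; omega
    simp [this]
  · simp

lemma SS_coeff (x : XX m) (j : ℕ) (hj : j ≤ m) : (SS x).coeff (m - j) = conj (cf x j) := by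
  rw [SS_apply, finsetSum_coeff, Finset.sum_eq_single j]
  · simp
  · intro k hk hkj
    simp at hk
    rw [coeff_C_mul_X_pow, if_neg (by omega)]
  · simp; omega

lemma eq_zero_of_SS (x : XX m) (h : SS x = 0) : x = 0 := by
  have hc (j : ℕ) (hj : j ≤ m) : cf x j = 0 := by
    have := SS_coeff x j hj
    rw [h] at this
    simpa using this.symm
  refine Prod.ext (funext fun j => ?_) ?_
  · have := hc j j.2.le
    simpa [cf] using this
  · have := hc m le_rfl
    simpa [cf] using this

/-- product form -/
lemma SS_prod (x : XX m) (a : Fin m → ℂ) (r : ℝ) (hp : pp x = C (r : ℂ) * ∏ k, (X - C (a k))) :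
    SS x = C (r : ℂ) * ∏ k, (1 - C (conj (a k)) * X) := by
  refine poly_eq_of_circle _ _ fun z hz => ?_
  have hzz := mul_conj_of_norm hz
  rw [SS_eval x z hz, hp]
  simp only [eval_mul, eval_C, eval_prod, eval_sub, eval_X, eval_one, map_mul, conj_ofReal, map_prod,
    map_sub]
  have : z ^ m = ∏ _k : Fin m, z := by simp
  rw [this, mul_left_comm, ← Finset.prod_mul_distrib]
  congr 1
  refine Finset.prod_congr rfl fun k _ => ?_
  linear_combination hzz

lemma exists_x (a : Fin m → ℂ) (r : ℝ) :
    ∃ x : XX m, x.2 = r ∧ pp x = C (r : ℂ) * ∏ k, (X - C (a k)) := by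
  set F : ℂ[X] := C (r : ℂ) * ∏ k, (X - C (a k)) with hF
  have hmon : (∏ k, (X - C (a k))).Monic := monic_prod_of_monic _ _ fun k _ => monic_X_sub_C _
  have hdeg : (∏ k, (X - C (a k))).natDegree = m := by
    rw [natDegree_prod_of_monic _ _ fun k _ => monic_X_sub_C _]; simp
  have hc : F.coeff m = r := by
    rw [hF, coeff_C_mul]
    have := hmon.coeff_natDegree
    rw [hdeg] at this
    rw [this, mul_one]
  have hd : F.natDegree < m + 1 := by
    have := natDegree_C_mul_le (r : ℂ) (∏ k, (X - C (a k)))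
    rw [hF]; omega
  refine ⟨(fun j => F.coeff j, r), rfl, ?_⟩
  refine Eq.trans ?_ (F.as_sum_range_C_mul_X_pow' hd).symm
  rw [pp]
  refine Finset.sum_congr rfl fun j hj => ?_
  congr 2
  unfold cf
  split_ifs with h
  · rfl
  · have : j = m := by simp at hj; omega
    rw [this, hc]

lemma norm_sub_le (a z : ℂ) (ha : ‖a‖ < 1) (hz : ‖z‖ < 1) : ‖z - a‖ ≤ ‖1 - conj a * z‖ := by
  have h1 : ‖1 - conj a * z‖ ^ 2 - ‖z - a‖ ^ 2 = (1 - ‖a‖ ^ 2) * (1 - ‖z‖ ^ 2) := by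
    simp only [← Complex.normSq_eq_norm_sq, Complex.normSq_apply]
    simp; ring
  have h2 : 0 ≤ (1 - ‖a‖ ^ 2) * (1 - ‖z‖ ^ 2) := by
    apply mul_nonneg <;> nlinarith [norm_nonneg a, norm_nonneg z]
  exact le_of_sq_le_sq (by linarith) (norm_nonneg _)

lemma ff_open (hm : 1 ≤ m) {ζ : Fin (2 * m + 1) → ℂ} (hζ : Function.Injective ζ)
    (hζ1 : ∀ i, ‖ζ i‖ = 1) (x : XX m) (a : Fin m → ℂ) (ha : ∀ k, ‖a k‖ < 1) (hr : 0 < x.2)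
    (hp : pp x = C (x.2 : ℂ) * ∏ k, (X - C (a k))) : map (ff ζ) (𝓝 x) = 𝓝 (ff ζ x) := by
  obtain ⟨f', hf, hf'⟩ := ff_strict ζ x
  refine hf.map_nhds_eq_of_surj ?_
  have hfin : Module.finrank ℝ (XX m) = Module.finrank ℝ (Fin (2 * m + 1) → ℝ) := by
    simp [Module.finrank_pi_fintype]; ring
  have hinj : Function.Injective (f' : XX m →ₗ[ℝ] (Fin (2 * m + 1) → ℝ)) := by
    rw [← LinearMap.ker_eq_bot, LinearMap.ker_eq_bot']
    intro y hy
    have hd : dWp x y = 0 := by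
      refine poly_eq_of_points hζ _ _ (natDegree_dWp hm x y) (by simp) fun i => ?_
      have h1 : ((dWp x y).eval (ζ i) * conj (ζ i) ^ m).re = 0 := by
        rw [← hf']; exact congrFun hy i
      have h2 : (dWp x y).eval (ζ i) * conj (ζ i) ^ m = 0 :=
        Complex.ext h1 (dWp_real x y _ (hζ1 i))
      have h3 : conj (ζ i) ≠ 0 := by
        intro h; have := mul_conj_of_norm (hζ1 i); rw [h] at this; simp at this
      simpa [h3] using h2
    apply eq_zero_of_SS
    have hS := SS_prod x a x.2 hp
    set s := x.2 * ∏ k, (1 - ‖a k‖) with hs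
    have hs0 : 0 < s := mul_pos hr (Finset.prod_pos fun k _ => by linarith [ha k])
    refine T_eq_zero (n := m + 1) (PP x) (SS x) (PP y) (SS y) (SS_eval_P x) (SS_eval_P y) hd (s ^ 2)
      (by positivity) ?_ (by simp [PP_apply]) (by simp [PP_apply]) x.2 y.2 (SS_zero x) hr.ne' (SS_zero y)
    intro z hz
    have e1 : s ≤ ‖(SS x).eval z‖ := by
      rw [hS, hs]
      simp only [eval_mul, eval_C, eval_prod, eval_sub, eval_X, eval_one, norm_mul, norm_prod,
        Complex.norm_real, Real.norm_eq_abs, abs_of_pos hr]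
      refine mul_le_mul_of_nonneg_left (Finset.prod_le_prod (fun k _ => by linarith [ha k]) fun k _ => ?_) hr.le
      have := norm_sub_norm_le (1:ℂ) (conj (a k) * z)
      rw [norm_mul, RCLike.norm_conj, norm_one] at this
      nlinarith [norm_nonneg (a k), norm_nonneg z]
    have e2 : ‖(PP x).eval z‖ ≤ ‖z‖ * ‖(SS x).eval z‖ := by
      rw [PP_apply, hp, hS]
      simp only [eval_mul, eval_C, eval_prod, eval_sub, eval_X, eval_one, norm_mul, norm_prod]
      gcongr with k
      exact norm_sub_le _ _ (ha k) hz
    unfold Nf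
    have e3 : ‖(PP x).eval z‖ ^ 2 ≤ ‖z‖ ^ 2 * ‖(SS x).eval z‖ ^ 2 := by
      rw [← mul_pow]; gcongr
    have e4 : s ^ 2 ≤ ‖(SS x).eval z‖ ^ 2 := by gcongr
    have e5 : ‖z‖ ^ 2 ≤ ‖z‖ := by nlinarith [norm_nonneg z]
    nlinarith [sq_nonneg s, sq_nonneg ‖(SS x).eval z‖, norm_nonneg z]
  have := (LinearMap.injective_iff_surjective_of_finrank_eq_finrank hfin).1 hinj
  exact LinearMap.range_eq_top.2 this

end BlaschkeAux

namespace BlaschkeAux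
open Polynomial Filter Topology
variable {m : ℕ}

noncomputable def Wf (a : Fin m → ℂ) (z : ℂ) : ℂ :=
  ∏ k, ((z - a k) * (1 - conj (a k) * z)) +
    z * ∑ k, (1 - a k * conj (a k)) * ∏ j ∈ univ.erase k, ((z - a j) * (1 - conj (a j) * z))

noncomputable def Tf (ξ : Fin m → ℂ) (z : ℂ) : ℂ := ∏ j, ((z - ξ j) * (1 - conj (ξ j) * z))

lemma Wf_eq (a : Fin m → ℂ) (z : ℂ) :
    (derivative (X * ∏ k, (X - C (a k))) * ∏ k, (1 - C (conj (a k)) * X) -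
      X * (∏ k, (X - C (a k))) * derivative (∏ k, (1 - C (conj (a k)) * X))).eval z = Wf a z := by
  simp only [derivative_mul, derivative_X, derivative_prod_finset, eval_sub, eval_mul, eval_add, eval_X,
    eval_one, one_mul, eval_finsetSum, eval_prod, derivative_sub, derivative_C, derivative_one,
    eval_C, zero_mul, zero_add, zero_sub, sub_zero, mul_one, eval_neg]
  rw [Wf, Finset.prod_mul_distrib]
  have key : (∑ k, ∏ j ∈ univ.erase k, (z - a j)) * ∏ k, (1 - conj (a k) * z) -
      (∏ k, (z - a k)) * ∑ k, (∏ j ∈ univ.erase k, (1 - conj (a j) * z)) * (-conj (a k)) =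
      ∑ k, (1 - a k * conj (a k)) * ∏ j ∈ univ.erase k, ((z - a j) * (1 - conj (a j) * z)) := by
    rw [Finset.sum_mul, Finset.mul_sum, ← Finset.sum_sub_distrib]
    refine Finset.sum_congr rfl fun k _ => ?_
    rw [Finset.prod_mul_distrib, ← Finset.mul_prod_erase univ (fun k => (z - a k)) (mem_univ k),
      ← Finset.mul_prod_erase univ (fun k => (1 - conj (a k) * z)) (mem_univ k)]
    ring
  rw [← key]
  ring

lemma Wp_eq (x : XX m) (a : Fin m → ℂ) (r : ℝ) (hp : pp x = C (r : ℂ) * ∏ k, (X - C (a k))) (z : ℂ) :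
    (Wp x).eval z = ((r ^ 2 : ℝ) : ℂ) * Wf a z := by
  rw [← Wf_eq, Wp, PP_apply, SS_prod x a r hp, hp]
  rw [show X * (C (r:ℂ) * ∏ k, (X - C (a k))) = C (r:ℂ) * (X * ∏ k, (X - C (a k))) by ring]
  simp only [derivative_C_mul, eval_sub, eval_mul, eval_C]
  push_cast
  ring

def Good (ξ : Fin m → ℂ) : Prop :=
  ∃ (a : Fin m → ℂ) (R : ℝ), (∀ k, ‖a k‖ < 1) ∧ 0 < R ∧ ∀ z, (R : ℂ) * Wf a z = Tf ξ z

lemma exists_fin (s : Multiset ℂ) (h : Multiset.card s = m) :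
    ∃ a : Fin m → ℂ, s = Multiset.map a univ.val := by
  subst h
  induction s using Quotient.inductionOn with
  | h l =>
    refine ⟨fun k => l.get k, ?_⟩
    rw [Fin.univ_val_map]
    exact congrArg _ (List.ofFn_get l).symm

lemma roots_form (x : XX m) (hr : 0 < x.2)
    (hS : ∀ z ∈ Metric.closedBall (0:ℂ) 1, (SS x).eval z ≠ 0) :
    ∃ a : Fin m → ℂ, (∀ k, ‖a k‖ < 1) ∧ pp x = C (x.2 : ℂ) * ∏ k, (X - C (a k)) := by
  have hc : (pp x).coeff m = x.2 := by
    rw [pp, finsetSum_coeff, Finset.sum_eq_single m]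
    · simp [cf]
    · intro j hj hjm
      rw [coeff_C_mul_X_pow, if_neg (Ne.symm hjm)]
    · simp
  have hr' : (x.2 : ℂ) ≠ 0 := by exact_mod_cast hr.ne'
  have hd : (pp x).natDegree = m :=
    le_antisymm (natDegree_pp x) (le_natDegree_of_ne_zero (by rw [hc]; exact hr'))
  have hsp := IsAlgClosed.splits (pp x)
  obtain ⟨a, ha⟩ := exists_fin (m := m) (pp x).roots (by rw [← hsp.natDegree_eq_card_roots, hd])
  have h1 := hsp.eq_prod_roots
  rw [ha, leadingCoeff, hd, hc, Multiset.map_map] at h1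
  have h2 : pp x = C (x.2 : ℂ) * ∏ k, (X - C (a k)) := h1
  refine ⟨a, fun k => ?_, h2⟩
  by_contra hk
  push Not at hk
  have ha0 : conj (a k) ≠ 0 := by
    intro h
    have : a k = 0 := by simpa using h
    rw [this] at hk; simp at hk; linarith
  refine hS (conj (a k))⁻¹ ?_ ?_
  · simp only [mem_closedBall_zero_iff, norm_inv, RCLike.norm_conj]
    exact inv_le_one_of_one_le₀ hk
  · rw [SS_prod x a x.2 h2]
    simp only [eval_mul, eval_prod, eval_sub, eval_one, eval_C, eval_X]
    rw [Finset.prod_eq_zero (mem_univ k), mul_zero]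
    rw [mul_inv_cancel₀ ha0, sub_self]

lemma continuous_Tf (z : ℂ) : Continuous fun ξ : Fin m → ℂ => Tf ξ z := by
  unfold Tf
  refine continuous_finsetProd _ fun j _ => ?_
  have : Continuous fun ξ : Fin m → ℂ => conj (ξ j) := Complex.continuous_conj.comp (continuous_apply j)
  fun_prop

lemma continuous_Wf (z : ℂ) : Continuous fun a : Fin m → ℂ => Wf a z := by
  unfold Wf
  have hj (j : Fin m) : Continuous fun ξ : Fin m → ℂ => conj (ξ j) := Complex.continuous_conj.comp (continuous_apply j)
  fun_prop

lemma factor_circle (a z : ℂ) (hz : ‖z‖ = 1) :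
    (z - a) * (1 - conj a * z) = z * ((‖z - a‖ ^ 2 : ℝ) : ℂ) := by
  rw [← Complex.normSq_eq_norm_sq, ← Complex.mul_conj, map_sub]
  linear_combination (-(z - a)) * mul_conj_of_norm hz

lemma Tf_circle (ξ : Fin m → ℂ) (z : ℂ) (hz : ‖z‖ = 1) :
    Tf ξ z = z ^ m * ((∏ j, ‖z - ξ j‖ ^ 2 : ℝ) : ℂ) := by
  unfold Tf
  rw [Finset.prod_congr rfl fun j _ => factor_circle (ξ j) z hz, Finset.prod_mul_distrib]
  simp

lemma Wf_circle (a : Fin m → ℂ) (z : ℂ) (hz : ‖z‖ = 1) :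
    Wf a z = z ^ m * ((∏ j, ‖z - a j‖ ^ 2 +
      ∑ k, (1 - ‖a k‖ ^ 2) * ∏ j ∈ univ.erase k, ‖z - a j‖ ^ 2 : ℝ) : ℂ) := by
  unfold Wf
  rw [show ∏ k, ((z - a k) * (1 - conj (a k) * z)) = Tf a z from rfl, Tf_circle a z hz]
  have (k : Fin m) : z * ((1 - a k * conj (a k)) * ∏ j ∈ univ.erase k, ((z - a j) * (1 - conj (a j) * z)))
      = z ^ m * (((1 - ‖a k‖ ^ 2) * ∏ j ∈ univ.erase k, ‖z - a j‖ ^ 2 : ℝ) : ℂ) := by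
    rw [Finset.prod_congr rfl fun j _ => factor_circle (a j) z hz, Finset.prod_mul_distrib,
      Complex.mul_conj, Complex.normSq_eq_norm_sq]
    have hm : m = (m - 1) + 1 := by have := k.2; omega
    have : z ^ m = z ^ (m - 1) * z := by conv_lhs => rw [hm, pow_succ]
    rw [this]
    simp only [Finset.prod_const, Finset.card_erase_of_mem (mem_univ k), Finset.card_univ, Fintype.card_fin]
    push_cast
    ring
  rw [Finset.mul_sum, Finset.sum_congr rfl fun k _ => this k, ← Finset.mul_sum]
  push_cast
  ring

lemma Tf_poly (ξ : Fin m → ℂ) : ∃ F : ℂ[X], F.natDegree ≤ 2 * m ∧ ∀ z, F.eval z = Tf ξ z := by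
  refine ⟨∏ j, ((X - C (ξ j)) * (1 - C (conj (ξ j)) * X)), ?_, fun z => ?_⟩
  · refine (natDegree_prod_le _ _).trans ?_
    refine (Finset.sum_le_card_nsmul _ _ 2 fun j _ => ?_).trans (by simp; omega)
    compute_degree
  · simp [Tf, eval_prod]

lemma Tf_ne_zero (ξ : Fin m → ℂ) (hξ : ∀ j, ‖ξ j‖ < 1) (z : ℂ) (hz : ‖z‖ = 1) : 
    0 < (∏ j, ‖z - ξ j‖ ^ 2) := by
  refine Finset.prod_pos fun j _ => ?_
  have : z - ξ j ≠ 0 := by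
    intro h
    have := hξ j
    rw [← sub_eq_zero.1 h, hz] at this
    exact lt_irrefl _ this
  positivity

lemma good_open (hm : 1 ≤ m) : IsOpen {ξ : Fin m → ℂ | Good ξ} := by
  rw [isOpen_iff_mem_nhds]
  rintro ξ0 ⟨a, R, ha, hR, h⟩
  obtain ⟨ζ, hζ, hζ1⟩ := exists_points m
  obtain ⟨x, hx2, hp⟩ := exists_x a (√R)
  have hx0 : 0 < x.2 := by rw [hx2]; positivity
  have hmap := ff_open hm hζ hζ1 x a ha hx0 (by rw [hx2]; exact hp)
  have hO1 : ∀ᶠ y in 𝓝 x, 0 < y.2 := continuous_snd.continuousAt.eventually (lt_mem_nhds hx0)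
  have hO2 : ∀ᶠ y in 𝓝 x, ∀ z ∈ Metric.closedBall (0:ℂ) 1, (SS y).eval z ≠ 0 := by
    refine (isCompact_closedBall (0:ℂ) 1).eventually_forall_of_forall_eventually fun z hz => ?_
    have hcont : Continuous fun q : XX m × ℂ => (SS q.1).eval q.2 := by
      simp only [SS_apply, eval_finsetSum, eval_mul, eval_C, eval_pow, eval_X]
      refine continuous_finsetSum _ fun j _ => ?_
      refine Continuous.mul (Complex.continuous_conj.comp ?_) (by fun_prop)
      unfold cf
      split_ifs
      · fun_prop
      · fun_prop
    refine hcont.continuousAt.eventually (isOpen_ne.mem_nhds ?_)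
    show (SS x).eval z ≠ 0
    rw [SS_prod x a _ hp]
    simp only [eval_mul, eval_prod, eval_sub, eval_one, eval_C, eval_X]
    refine mul_ne_zero (by rw [← hx2]; exact_mod_cast hx0.ne') (Finset.prod_ne_zero_iff.2 fun k _ => ?_)
    intro h0
    have h1 : ‖conj (a k) * z‖ = 1 := by rw [← sub_eq_zero.1 h0]; simp
    rw [norm_mul, RCLike.norm_conj] at h1
    simp at hz
    nlinarith [ha k, norm_nonneg (a k), norm_nonneg z]
  have himg := image_mem_map (m := ff ζ) (hO1.and hO2)
  rw [hmap] at himg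
  set τ : (Fin m → ℂ) → Fin (2 * m + 1) → ℝ := fun ξ i => (Tf ξ (ζ i) * conj (ζ i) ^ m).re with hτ
  have hτc : Continuous τ := by
    refine continuous_pi fun i => Complex.continuous_re.comp ?_
    exact (continuous_Tf (ζ i)).mul continuous_const
  have hτ0 : τ ξ0 = ff ζ x := by
    funext i
    simp only [hτ, ff]
    rw [Wp_eq x a _ hp, Real.sq_sqrt hR.le, h]
  rw [← hτ0] at himg
  filter_upwards [hτc.continuousAt.preimage_mem_nhds himg] with ξ hξ
  obtain ⟨y, ⟨hy1, hy2⟩, hy⟩ := hξ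
  obtain ⟨b, hb, hpb⟩ := roots_form y hy1 hy2
  refine ⟨b, y.2 ^ 2, hb, by positivity, fun z => ?_⟩
  rw [← Wp_eq y b _ hpb]
  obtain ⟨F, hF1, hF2⟩ := Tf_poly ξ
  rw [← hF2]
  congr 1
  refine poly_eq_of_points hζ _ _ (natDegree_W1 hm y y) hF1 fun i => ?_
  rw [hF2]
  have hzz := mul_conj_of_norm (hζ1 i)
  have h3 : conj (ζ i) ≠ 0 := by
    intro h; rw [h] at hzz; simp at hzz
  refine mul_right_cancel₀ (pow_ne_zero m h3) ?_
  refine Complex.ext (congrFun hy i) ?_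
  rw [Wp_real y _ (hζ1 i), Tf_circle ξ _ (hζ1 i)]
  have : ζ i ^ m * ((∏ j, ‖ζ i - ξ j‖ ^ 2 : ℝ) : ℂ) * conj (ζ i) ^ m =
      ((∏ j, ‖ζ i - ξ j‖ ^ 2 : ℝ) : ℂ) := by
    have : ζ i ^ m * conj (ζ i) ^ m = 1 := by rw [← mul_pow, hzz, one_pow]
    linear_combination ((∏ j, ‖ζ i - ξ j‖ ^ 2 : ℝ) : ℂ) * this
  rw [this, Complex.ofReal_im]

lemma good_closed (ξ : Fin m → ℂ) (hξ : ∀ j, ‖ξ j‖ < 1) (hcl : ξ ∈ closure {ξ : Fin m → ℂ | Good ξ}) :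
    Good ξ := by
  obtain ⟨s, hs, hlim⟩ := mem_closure_iff_seq_limit.1 hcl
  choose a R ha hR h using hs
  have hcpt : IsCompact (Metric.closedBall (0 : Fin m → ℂ) 1) := isCompact_closedBall _ _
  obtain ⟨b, hb, φ, hφ, hab⟩ := hcpt.tendsto_subseq (x := a) (fun i => by
    simp only [mem_closedBall_zero_iff]
    exact (pi_norm_le_iff_of_nonneg zero_le_one).2 fun k => (ha i k).le)
  have hb' (k : Fin m) : ‖b k‖ ≤ 1 := by
    simp only [mem_closedBall_zero_iff] at hb
    exact (norm_le_pi_norm b k).trans hb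
  obtain ⟨z, hz, hzb⟩ : ∃ z : ℂ, ‖z‖ = 1 ∧ ∀ k, z ≠ b k := by
    obtain ⟨z, hz, hz'⟩ := (circle_infinite.sdiff (Set.finite_range b)).nonempty
    exact ⟨z, hz, fun k hk => hz' ⟨k, hk.symm⟩⟩
  have hz0 : z ≠ 0 := by intro h; rw [h] at hz; simp at hz
  set wb : ℝ := ∏ j, ‖z - b j‖ ^ 2 +
      ∑ k, (1 - ‖b k‖ ^ 2) * ∏ j ∈ univ.erase k, ‖z - b j‖ ^ 2 with hwb
  have hwb0 : 0 < wb := by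
    have h1 : 0 < ∏ j, ‖z - b j‖ ^ 2 := Finset.prod_pos fun j _ => by
      have := sub_ne_zero.2 (hzb j); positivity
    have h2 : 0 ≤ ∑ k, (1 - ‖b k‖ ^ 2) * ∏ j ∈ univ.erase k, ‖z - b j‖ ^ 2 :=
      Finset.sum_nonneg fun k _ => mul_nonneg (by nlinarith [hb' k, norm_nonneg (b k)])
        (Finset.prod_nonneg fun j _ => by positivity)
    linarith
  have hWb : Wf b z = z ^ m * (wb : ℂ) := Wf_circle b z hz
  have hWb0 : Wf b z ≠ 0 := by
    rw [hWb]; exact mul_ne_zero (pow_ne_zero _ hz0) (by exact_mod_cast hwb0.ne')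
  have hT (z : ℂ) : Tendsto (fun i => Tf (s (φ i)) z) atTop (𝓝 (Tf ξ z)) :=
    ((continuous_Tf z).tendsto ξ).comp (hlim.comp hφ.tendsto_atTop)
  have hW (z : ℂ) : Tendsto (fun i => Wf (a (φ i)) z) atTop (𝓝 (Wf b z)) :=
    ((continuous_Wf z).tendsto b).comp hab
  set R0 : ℝ := (∏ j, ‖z - ξ j‖ ^ 2) / wb with hR0
  have hR0p : 0 < R0 := div_pos (Tf_ne_zero ξ hξ z hz) hwb0
  have hRlim : Tendsto (fun i => (R (φ i) : ℂ)) atTop (𝓝 (R0 : ℂ)) := by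
    have h1 := (hT z).div (hW z) hWb0
    have h2 : Tf ξ z / Wf b z = (R0 : ℂ) := by
      rw [hWb, Tf_circle ξ z hz, hR0, mul_div_mul_left _ _ (pow_ne_zero _ hz0)]
      push_cast; rfl
    rw [h2] at h1
    refine h1.congr' ?_
    filter_upwards [(hW z).eventually_ne hWb0] with i hi
    show Tf (s (φ i)) z / Wf (a (φ i)) z = _
    rw [← h (φ i) z]
    field_simp
  have hfin (z : ℂ) : (R0 : ℂ) * Wf b z = Tf ξ z := by
    refine tendsto_nhds_unique (hRlim.mul (hW z)) ?_
    refine (hT z).congr fun i => (h (φ i) z).symm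
  refine ⟨b, R0, fun k => ?_, hR0p, hfin⟩
  refine lt_of_le_of_ne (hb' k) fun hk => ?_
  have h1 := hfin (b k)
  have h2 : Wf b (b k) = 0 := by
    unfold Wf
    rw [Finset.prod_eq_zero (mem_univ k) (by simp), zero_add, Finset.sum_eq_zero, mul_zero]
    intro l _
    by_cases hl : l = k
    · subst hl
      rw [mul_conj_of_norm hk]; simp
    · rw [Finset.prod_eq_zero (mem_erase.2 ⟨Ne.symm hl, mem_univ k⟩) (by simp), mul_zero]
  rw [h2, mul_zero, Tf_circle ξ _ hk] at h1
  have hbk : b k ≠ 0 := by intro h; rw [h] at hk; simp at hk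
  have := mul_ne_zero (pow_ne_zero m hbk)
    (Complex.ofReal_ne_zero.2 (Tf_ne_zero ξ hξ (b k) hk).ne')
  exact this h1.symm

lemma good_zero (hm : 1 ≤ m) : Good (0 : Fin m → ℂ) := by
  refine ⟨0, ((m + 1 : ℕ) : ℝ)⁻¹, by simp, by positivity, fun z => ?_⟩
  have : (m : ℂ) + 1 ≠ 0 := by exact_mod_cast Nat.succ_ne_zero m
  obtain ⟨l, rfl⟩ : ∃ l, m = l + 1 := ⟨m - 1, by omega⟩
  simp [Wf, Tf, Finset.card_erase_of_mem] at this ⊢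
  field_simp
  ring

lemma good_all (hm : 1 ≤ m) (ξ : Fin m → ℂ) (hξ : ∀ j, ‖ξ j‖ < 1) : Good ξ := by
  have hpre : IsPreconnected (Metric.ball (0 : Fin m → ℂ) 1) := (convex_ball _ _).isPreconnected
  refine hpre.subset_of_closure_inter_subset (good_open hm) ⟨0, by simp, good_zero hm⟩ ?_ ?_
  · rintro ξ' ⟨h1, h2⟩
    refine good_closed ξ' (fun j => ?_) h1
    simp only [mem_ball_zero_iff] at h2
    exact (norm_le_pi_norm ξ' j).trans_lt h2
  · simp only [mem_ball_zero_iff]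
    exact (pi_norm_lt_iff zero_lt_one).2 hξ

lemma final (ξ : Fin m → ℂ) (h : Good ξ) :
    ∃ (a : Fin (m + 1) → ℂ) (c c' : ℂ),
      (∀ k, ‖a k‖ < 1) ∧ ‖c‖ = 1 ∧ c' ≠ 0 ∧
      ∀ z : ℂ, (∀ k, 1 - conj (a k) * z ≠ 0) →
        deriv (fun w => c * ∏ k, (w - a k) / (1 - conj (a k) * w)) z *
            ∏ k, (1 - conj (a k) * z) ^ 2 =
          c' * ∏ j, (z - ξ j) * (1 - conj (ξ j) * z) := by
  obtain ⟨a, R, ha, hR, h⟩ := h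
  have hR' : (R : ℂ) ≠ 0 := by exact_mod_cast hR.ne'
  refine ⟨Fin.cons 0 a, 1, (R : ℂ)⁻¹, ?_, by simp, inv_ne_zero hR', fun z hz => ?_⟩
  · intro k
    refine Fin.cases (by simp) (fun j => by simpa using ha j) k
  · set P : ℂ[X] := X * ∏ k, (X - C (a k)) with hP
    set S : ℂ[X] := ∏ k, (1 - C (conj (a k)) * X) with hS
    have hfun : (fun w : ℂ => (1:ℂ) * ∏ k : Fin (m + 1), (w - (Fin.cons 0 a : Fin (m + 1) → ℂ) k) /
        (1 - conj ((Fin.cons 0 a : Fin (m + 1) → ℂ) k) * w)) = fun w => P.eval w / S.eval w := by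
      funext w
      simp [Fin.prod_univ_succ, hP, hS, eval_prod, Finset.prod_div_distrib, mul_div_assoc]
    have hprod : ∏ k : Fin (m + 1), (1 - conj ((Fin.cons 0 a : Fin (m + 1) → ℂ) k) * z) ^ 2 =
        S.eval z ^ 2 := by
      simp [Fin.prod_univ_succ, hS, eval_prod, Finset.prod_pow]
    have hS0 : S.eval z ≠ 0 := by
      simp only [hS, eval_prod, eval_sub, eval_mul, eval_C, eval_X, eval_one]
      exact Finset.prod_ne_zero_iff.2 fun k _ => by simpa using hz k.succ
    rw [hfun, hprod, ((P.hasDerivAt z).fun_div (S.hasDerivAt z) hS0).deriv,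
      div_mul_cancel₀ _ (pow_ne_zero 2 hS0)]
    have h1 := Wf_eq a z
    rw [← hP, ← hS, eval_sub, eval_mul, eval_mul] at h1
    rw [h1, show ∏ j, (z - ξ j) * (1 - conj (ξ j) * z) = Tf ξ z from rfl, ← h z]
    field_simp

end BlaschkeAux

/-- **Existence of a finite Blaschke product with prescribed critical points.**
Given `n ≥ 2` and points `ξ 1, …, ξ (n-1)` in the open unit disc, there is a finite
Blaschke product `B` of degree `n` whose critical points in the disc are precisely the
`ξ j` counted with multiplicity, in the sense that the degree `2n-2` polynomial
`B'(z) · ∏ (1 - conj (a k) z)²` equals `c' · ∏ (z - ξ j)(1 - conj (ξ j) z)`. -/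
theorem blaschke_exists_with_critical_points
    (n : ℕ) (hn : 2 ≤ n) (ξ : Fin (n - 1) → ℂ) (hξ : ∀ j, ‖ξ j‖ < 1) :
    ∃ (a : Fin n → ℂ) (c c' : ℂ),
      (∀ k, ‖a k‖ < 1) ∧ ‖c‖ = 1 ∧ c' ≠ 0 ∧
      ∀ z : ℂ, (∀ k, 1 - conj (a k) * z ≠ 0) →
        deriv (fun w => c * ∏ k, (w - a k) / (1 - conj (a k) * w)) z *
            ∏ k, (1 - conj (a k) * z) ^ 2 =
          c' * ∏ j, (z - ξ j) * (1 - conj (ξ j) * z) := by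
  obtain ⟨m, rfl⟩ : ∃ m, n = m + 1 := ⟨n - 1, by omega⟩
  exact BlaschkeAux.final (m := m) ξ (BlaschkeAux.good_all (m := m) (by omega) ξ hξ)
end

section
/- Let n ≥ 2, let ξ_1, …, ξ_{n-1} ∈ 𝔻, and let B₁ and B₂ be finite Blaschke products of degree n that both have critical points precisely ξ_1, …, ξ_{n-1} counted with multiplicity (i.e., for i = 1, 2, B_i'(z)·∏_{k=1}^n (1 - conj(a_k^{(i)})·z)² = c_i'·∏_{j=1}^{n-1} (z - ξ_j)(1 - conj(ξ_j)·z) for some nonzero constants c_i', where a_k^{(i)} are the zeros of B_i). Then B₂ = φ ∘ B₁ for some conformal automorphism φ of 𝔻, i.e., there exist α ∈ 𝔻 and θ ∈ ℝ such that B₂(z) = e^{iθ}·(B₁(z) - α)/(1 - conj(α)·B₁(z)) for all z ∈ 𝔻. -/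
open Complex ComplexConjugate Finset

theorem aux_second_test (g g' : ℝ → ℝ) (g'' : ℝ)
    (h1 : ∀ᶠ t in nhds 0, HasDerivAt g (g' t) t) (h2 : HasDerivAt g' g'' 0)
    (hm : IsLocalMax g 0) : g'' ≤ 0 := by
  by_contra hcon
  push Not at hcon
  have e1 : deriv g =ᶠ[nhds 0] g' := h1.mono (fun t ht => ht.deriv)
  have e2 : deriv (deriv g) 0 = g'' := by
    rw [e1.deriv_eq, h2.deriv]
  have hmin : IsLocalMin g 0 := isLocalMin_of_deriv_deriv_pos (by rw [e2]; exact hcon)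
    hm.deriv_eq_zero h1.self_of_nhds.continuousAt
  have hconst : g =ᶠ[nhds 0] fun _ => g 0 := by
    filter_upwards [hm, hmin] with t a b
    exact le_antisymm a b
  have : deriv g =ᶠ[nhds 0] fun _ => 0 := by
    have := hconst.deriv
    simpa using this
  have e3 := this.deriv_eq
  rw [e2] at e3
  simp at e3
  linarith

/-- Blaschke data by induction. -/
theorem aux_struct (n : ℕ) (a : Fin n → ℂ) (ha : ∀ k, ‖a k‖ < 1) (c : ℂ) (hc : ‖c‖ = 1) :
    ∃ K : ℂ → ℝ, Continuous K ∧
      (∀ z, ‖∏ k, (1 - conj (a k) * z)‖ ^ 2 - ‖c * ∏ k, (z - a k)‖ ^ 2 = (1 - ‖z‖ ^ 2) * K z) ∧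
      (∀ z, ‖z‖ ≤ 1 → 0 ≤ K z) ∧ (∀ z, ‖z‖ ≤ 1 → 1 ≤ n → 0 < K z) ∧
      (∀ z, ‖z‖ = 1 → (c * ∏ k, (z - a k)) * (∏ k, (1 - conj (a k) * z)) =
        c * z ^ n * (‖c * ∏ k, (z - a k)‖ ^ 2 : ℝ)) ∧
      (∀ z, ‖z‖ = 1 → z * (deriv (fun z => c * ∏ k, (z - a k)) z * (∏ k, (1 - conj (a k) * z)) -
        (c * ∏ k, (z - a k)) * deriv (fun z => ∏ k, (1 - conj (a k) * z)) z) =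
        c * z ^ n * (K z : ℝ)) := by
  induction n with
  | zero =>
    refine ⟨fun _ => 0, continuous_const, ?_, ?_, ?_, ?_, ?_⟩ <;> simp [hc]
  | succ n ih =>
    obtain ⟨K, hK, h1, h2, h3, h4, h5⟩ := ih (fun k => a k.castSucc) (fun k => ha _)
    set b := a (Fin.last n) with hb
    have hbn : ‖b‖ < 1 := ha _
    have hb2 : 0 < 1 - ‖b‖ ^ 2 := by nlinarith [norm_nonneg b]
    have dP : ∀ z, DifferentiableAt ℂ (fun z => c * ∏ k : Fin n, (z - a k.castSucc)) z := by
      intro z; fun_prop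
    have dQ : ∀ z, DifferentiableAt ℂ (fun z => ∏ k : Fin n, (1 - conj (a k.castSucc) * z)) z := by
      intro z; fun_prop
    simp only [Fin.prod_univ_castSucc, ← mul_assoc, ← hb]
    set P : ℂ → ℂ := fun z => c * ∏ k : Fin n, (z - a k.castSucc) with hP
    set Q : ℂ → ℂ := fun z => ∏ k : Fin n, (1 - conj (a k.castSucc) * z) with hQ
    have hPz : ∀ z, c * ∏ k : Fin n, (z - a k.castSucc) = P z := fun z => rfl
    have hQz : ∀ z, ∏ k : Fin n, (1 - conj (a k.castSucc) * z) = Q z := fun z => rfl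
    simp only [hPz, hQz] at h1 h4 h5 ⊢
    have nb : ∀ z, ‖1 - conj b * z‖ ^ 2 - ‖z - b‖ ^ 2 = (1 - ‖z‖ ^ 2) * (1 - ‖b‖ ^ 2) := by
      intro z
      rw [← Complex.normSq_eq_norm_sq, ← Complex.normSq_eq_norm_sq, ← Complex.normSq_eq_norm_sq,
        ← Complex.normSq_eq_norm_sq]
      simp [Complex.normSq_apply]; ring
    have cb : ∀ z, ‖z‖ = 1 → (z - b) * (1 - conj b * z) = z * (‖z - b‖ ^ 2 : ℝ) := by
      intro z hz
      have hzz : z * conj z = 1 := by rw [Complex.mul_conj, Complex.normSq_eq_norm_sq, hz]; simp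
      rw [← Complex.normSq_eq_norm_sq, ← Complex.mul_conj, map_sub]
      linear_combination (-(z - b)) * hzz
    have pb : ∀ z, ‖z‖ ≤ 1 → 0 < ‖1 - conj b * z‖ := by
      intro z hz
      rw [norm_pos_iff]
      intro h0
      have : ‖conj b * z‖ = 1 := by rw [← sub_eq_zero.mp h0]; simp
      rw [norm_mul, Complex.norm_conj] at this
      nlinarith [norm_nonneg b, norm_nonneg z]
    refine ⟨fun z => ‖1 - conj b * z‖ ^ 2 * K z + ‖P z‖ ^ 2 * (1 - ‖b‖ ^ 2), ?_, ?_, ?_, ?_, ?_, ?_⟩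
    · have : Continuous P := by fun_prop
      fun_prop
    · intro z
      rw [norm_mul, norm_mul]
      linear_combination ‖1 - conj b * z‖ ^ 2 * h1 z + ‖P z‖ ^ 2 * nb z
    · intro z hz
      have := h2 z hz
      positivity
    · intro z hz _
      have h2z := h2 z hz
      rcases Nat.eq_zero_or_pos n with h0 | h0
      · subst h0
        have : ‖P z‖ = 1 := by simp [hP, hc]
        beta_reduce
        rw [this]
        nlinarith [mul_nonneg (sq_nonneg ‖1 - conj b * z‖) h2z]
      · have := h3 z hz h0
        have := pb z hz
        positivity
    · intro z hz
      have := h4 z hz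
      have := cb z hz
      rw [norm_mul]
      push_cast at *
      linear_combination (z - b) * (1 - conj b * z) * h4 z hz + c * z ^ n * ‖P z‖ ^ 2 * cb z hz
    · intro z hz
      have e1 : deriv (fun z => P z * (z - b)) z = deriv P z * (z - b) + P z := by
        have := (dP z).hasDerivAt.mul ((hasDerivAt_id z).sub_const b)
        have := this.deriv
        simp only [id, mul_one] at this
        exact this
      have e2 : deriv (fun z => Q z * (1 - conj b * z)) z
          = deriv Q z * (1 - conj b * z) - Q z * conj b := by
        have := (dQ z).hasDerivAt.mul (((hasDerivAt_id z).const_mul (conj b)).const_sub 1)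
        have := this.deriv
        simp only [id, mul_one, mul_neg, ← sub_eq_add_neg] at this
        exact this
      rw [e1, e2]
      have h4z := h4 z hz
      have h5z := h5 z hz
      have cbz := cb z hz
      have nbz : (‖z - b‖:ℂ) ^ 2 = ‖1 - conj b * z‖ ^ 2 := by
        have := nb z
        rw [hz] at this
        norm_cast
        linarith
      have hbb : b * conj b = ‖b‖ ^ 2 := by
        rw [Complex.mul_conj, Complex.normSq_eq_norm_sq]; simp
      push_cast at *
      linear_combination (z - b) * (1 - conj b * z) * h5z + c * z ^ n * (K z) * cbz
        + z * (1 - ‖b‖ ^ 2) * h4z + c * z ^ n * (K z) * z * nbz - z * P z * Q z * hbb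

theorem aux_line (f : ℂ → ℂ) (hf : Differentiable ℂ f) (z e : ℂ) (t : ℝ) :
    HasDerivAt (fun t : ℝ => f (z + t * e)) (e * deriv f (z + t * e)) t := by
  have h1 : HasDerivAt (fun t : ℂ => z + t * e) e (t : ℂ) := by
    simpa using ((hasDerivAt_id (t : ℂ)).mul_const e).const_add z
  have h2 := (hf (z + t * e)).hasDerivAt.comp (t : ℂ) h1
  have h3 := h2.comp_ofReal
  rw [mul_comm] at h3
  exact h3

theorem aux_deriv_diff (f : ℂ → ℂ) (hf : Differentiable ℂ f) : Differentiable ℂ (deriv f) := by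
  intro z
  exact ((hf.analyticAt z).deriv).differentiableAt

/-- first and second derivative of `‖Q‖² - ‖P‖²` along a line. -/
theorem aux_v (P Q : ℂ → ℂ) (hP : Differentiable ℂ P) (hQ : Differentiable ℂ Q) (z e : ℂ) (t : ℝ) :
    HasDerivAt (fun t : ℝ => ‖Q (z + t * e)‖ ^ 2 - ‖P (z + t * e)‖ ^ 2)
      (2 * inner ℝ (Q (z + t * e)) (e * deriv Q (z + t * e)) -
        2 * inner ℝ (P (z + t * e)) (e * deriv P (z + t * e))) t :=
  (aux_line Q hQ z e t).norm_sq.sub (aux_line P hP z e t).norm_sq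

theorem aux_v2 (P Q : ℂ → ℂ) (hP : Differentiable ℂ P) (hQ : Differentiable ℂ Q) (z e : ℂ) (t : ℝ) :
    HasDerivAt (fun t : ℝ => (2 * inner ℝ (Q (z + t * e)) (e * deriv Q (z + t * e)) -
        2 * inner ℝ (P (z + t * e)) (e * deriv P (z + t * e)) : ℝ))
      (2 * (inner ℝ (Q (z + t * e)) (e * (e * deriv (deriv Q) (z + t * e)))
          + inner ℝ (e * deriv Q (z + t * e)) (e * deriv Q (z + t * e))) -
        2 * (inner ℝ (P (z + t * e)) (e * (e * deriv (deriv P) (z + t * e)))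
          + inner ℝ (e * deriv P (z + t * e)) (e * deriv P (z + t * e)))) t :=
  (((aux_line Q hQ z e t).inner ℝ
    ((aux_line _ (aux_deriv_diff Q hQ) z e t).const_mul e)).const_mul 2).sub
  (((aux_line P hP z e t).inner ℝ
    ((aux_line _ (aux_deriv_diff P hP) z e t).const_mul e)).const_mul 2)

/-- second derivative of `log v`. -/
theorem aux_log2 (v v' : ℝ → ℝ) (v'' : ℝ) (h1 : ∀ t, HasDerivAt v (v' t) t)
    (h2 : HasDerivAt v' v'' 0) (h0 : 0 < v 0) :
    (∀ᶠ t in nhds 0, HasDerivAt (fun t => Real.log (v t)) (v' t / v t) t) ∧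
    HasDerivAt (fun t => v' t / v t) ((v'' * v 0 - v' 0 * v' 0) / v 0 ^ 2) 0 := by
  refine ⟨?_, h2.div (h1 0) h0.ne'⟩
  filter_upwards [(h1 0).continuousAt.eventually (lt_mem_nhds h0)] with t ht
  exact (h1 t).log ht.ne'

theorem aux_lap (p p' p'' q q' q'' : ℂ) :
   let D1 : ℂ → ℝ := fun e => 2 * inner ℝ q (e * q') - 2 * inner ℝ p (e * p')
   let D2 : ℂ → ℝ := fun e => 2 * (inner ℝ q (e * (e * q'')) + inner ℝ (e * q') (e * q'))
      - 2 * (inner ℝ p (e * (e * p'')) + inner ℝ (e * p') (e * p'))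
   let v := ‖q‖ ^ 2 - ‖p‖ ^ 2
   (D2 1 * v - D1 1 * D1 1) + (D2 I * v - D1 I * D1 I) = - 4 * ‖p' * q - p * q'‖ ^ 2 := by
  simp only [← Complex.normSq_eq_norm_sq, Complex.inner]
  simp [Complex.normSq_apply]
  ring

theorem aux_interior (P₁ Q₁ P₂ Q₂ : ℂ → ℂ) (hP₁ : Differentiable ℂ P₁) (hQ₁ : Differentiable ℂ Q₁)
    (hP₂ : Differentiable ℂ P₂) (hQ₂ : Differentiable ℂ Q₂) (z : ℂ) (s ε : ℝ) (hε : 0 < ε) (hs : 0 < s)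
    (hv₁ : 0 < ‖Q₁ z‖ ^ 2 - ‖P₁ z‖ ^ 2) (hv₂ : 0 < ‖Q₂ z‖ ^ 2 - ‖P₂ z‖ ^ 2)
    (hlt : s * (‖Q₂ z‖ ^ 2 - ‖P₂ z‖ ^ 2) ≤ ‖Q₁ z‖ ^ 2 - ‖P₁ z‖ ^ 2)
    (hW : ‖deriv P₁ z * Q₁ z - P₁ z * deriv Q₁ z‖ = s * ‖deriv P₂ z * Q₂ z - P₂ z * deriv Q₂ z‖)
    (hmax : IsLocalMax (fun w => Real.log (‖Q₁ w‖ ^ 2 - ‖P₁ w‖ ^ 2)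
      - Real.log (‖Q₂ w‖ ^ 2 - ‖P₂ w‖ ^ 2) + ε * ‖w‖ ^ 2) z) : False := by
  have key : ∀ e : ℂ, ‖e‖ = 1 →
     ((2 * (inner ℝ (Q₁ z) (e * (e * deriv (deriv Q₁) z)) + inner ℝ (e * deriv Q₁ z) (e * deriv Q₁ z))
      - 2 * (inner ℝ (P₁ z) (e * (e * deriv (deriv P₁) z)) + inner ℝ (e * deriv P₁ z) (e * deriv P₁ z)))
        * (‖Q₁ z‖ ^ 2 - ‖P₁ z‖ ^ 2) -
        (2 * inner ℝ (Q₁ z) (e * deriv Q₁ z) - 2 * inner ℝ (P₁ z) (e * deriv P₁ z)) *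
        (2 * inner ℝ (Q₁ z) (e * deriv Q₁ z) - 2 * inner ℝ (P₁ z) (e * deriv P₁ z)))
          / (‖Q₁ z‖ ^ 2 - ‖P₁ z‖ ^ 2) ^ 2 -
     ((2 * (inner ℝ (Q₂ z) (e * (e * deriv (deriv Q₂) z)) + inner ℝ (e * deriv Q₂ z) (e * deriv Q₂ z))
      - 2 * (inner ℝ (P₂ z) (e * (e * deriv (deriv P₂) z)) + inner ℝ (e * deriv P₂ z) (e * deriv P₂ z)))
        * (‖Q₂ z‖ ^ 2 - ‖P₂ z‖ ^ 2) -
        (2 * inner ℝ (Q₂ z) (e * deriv Q₂ z) - 2 * inner ℝ (P₂ z) (e * deriv P₂ z)) *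
        (2 * inner ℝ (Q₂ z) (e * deriv Q₂ z) - 2 * inner ℝ (P₂ z) (e * deriv P₂ z)))
          / (‖Q₂ z‖ ^ 2 - ‖P₂ z‖ ^ 2) ^ 2 + ε * 2 ≤ 0 := by
    intro e he
    have z0 : z + ((0:ℝ):ℂ) * e = z := by simp
    have A := aux_log2 _ _ _ (aux_v P₁ Q₁ hP₁ hQ₁ z e) (aux_v2 P₁ Q₁ hP₁ hQ₁ z e 0)
      (by simpa using hv₁)
    have B := aux_log2 _ _ _ (aux_v P₂ Q₂ hP₂ hQ₂ z e) (aux_v2 P₂ Q₂ hP₂ hQ₂ z e 0)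
      (by simpa using hv₂)
    have C1 : ∀ t : ℝ, HasDerivAt (fun t : ℝ => ε * ‖z + t * e‖ ^ 2)
        (ε * (2 * inner ℝ (z + t * e) e)) t := by
      intro t
      have := (aux_line id differentiable_id z e t).norm_sq.const_mul ε
      simpa using this
    have C2 : HasDerivAt (fun t : ℝ => ε * (2 * inner ℝ (z + t * e) e)) (ε * 2) 0 := by
      have := (((aux_line id differentiable_id z e 0).inner ℝ
        (hasDerivAt_const (0:ℝ) e)).const_mul 2).const_mul ε
      simpa [he] using this
    have T := aux_second_test _ _ _ ((A.1.and B.1).mono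
      (fun t ht => (ht.1.sub ht.2).add (C1 t))) ((A.2.sub B.2).add C2) ?_
    · simp only [z0] at T
      exact T
    · have hc : ContinuousAt (fun t : ℝ => z + (t : ℂ) * e) 0 := by fun_prop
      have hc' : Filter.Tendsto (fun t : ℝ => z + (t : ℂ) * e) (nhds 0) (nhds z) := by
        simpa [ContinuousAt] using hc
      have := hc'.eventually hmax
      filter_upwards [this] with t ht
      simp only [Pi.add_apply, Pi.sub_apply, z0]
      exact ht
  have k1 := key 1 (by simp)
  have k2 := key I (by simp)
  have L1 := aux_lap (P₁ z) (deriv P₁ z) (deriv (deriv P₁) z) (Q₁ z) (deriv Q₁ z) (deriv (deriv Q₁) z)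
  have L2 := aux_lap (P₂ z) (deriv P₂ z) (deriv (deriv P₂) z) (Q₂ z) (deriv Q₂ z) (deriv (deriv Q₂) z)
  have k3 := add_le_add k1 k2
  clear key k1 k2 hmax
  dsimp only at L1 L2
  rw [hW] at L1
  generalize ‖deriv P₂ z * Q₂ z - P₂ z * deriv Q₂ z‖ = w at *
  generalize ‖Q₁ z‖ ^ 2 - ‖P₁ z‖ ^ 2 = v₁ at *
  generalize ‖Q₂ z‖ ^ 2 - ‖P₂ z‖ ^ 2 = v₂ at *
  have k4 : -4 * (s * w) ^ 2 / v₁ ^ 2 - (-4 * w ^ 2 / v₂ ^ 2) + 4 * ε ≤ 0 := by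
    rw [← L1, ← L2]
    rw [add_div, add_div]
    linarith
  have k5 : (s * w) ^ 2 / v₁ ^ 2 ≤ w ^ 2 / v₂ ^ 2 := by
    rw [div_le_div_iff₀ (by positivity) (by positivity)]
    have : (s * v₂) ^ 2 ≤ v₁ ^ 2 := pow_le_pow_left₀ (by positivity) hlt 2
    nlinarith [sq_nonneg w]
  have k6 : -4 * (s * w) ^ 2 / v₁ ^ 2 = -4 * ((s * w) ^ 2 / v₁ ^ 2) := by ring
  have k7 : -4 * w ^ 2 / v₂ ^ 2 = -4 * (w ^ 2 / v₂ ^ 2) := by ring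
  rw [k6, k7] at k4
  linarith

theorem aux_max (P₁ Q₁ P₂ Q₂ : ℂ → ℂ) (hP₁ : Differentiable ℂ P₁) (hQ₁ : Differentiable ℂ Q₁)
    (hP₂ : Differentiable ℂ P₂) (hQ₂ : Differentiable ℂ Q₂) (s : ℝ) (hs : 0 < s)
    (K₁ K₂ : ℂ → ℝ) (hK₁ : Continuous K₁) (hK₂ : Continuous K₂)
    (pK₁ : ∀ z, ‖z‖ ≤ 1 → 0 < K₁ z) (pK₂ : ∀ z, ‖z‖ ≤ 1 → 0 < K₂ z)
    (hv₁ : ∀ z, ‖Q₁ z‖ ^ 2 - ‖P₁ z‖ ^ 2 = (1 - ‖z‖ ^ 2) * K₁ z)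
    (hv₂ : ∀ z, ‖Q₂ z‖ ^ 2 - ‖P₂ z‖ ^ 2 = (1 - ‖z‖ ^ 2) * K₂ z)
    (hb : ∀ z, ‖z‖ = 1 → K₁ z = s * K₂ z)
    (hW : ∀ z, ‖z‖ < 1 →
      ‖deriv P₁ z * Q₁ z - P₁ z * deriv Q₁ z‖ = s * ‖deriv P₂ z * Q₂ z - P₂ z * deriv Q₂ z‖)
    (z : ℂ) (hz : ‖z‖ < 1) : K₁ z ≤ s * K₂ z := by
  by_contra hcon
  push Not at hcon
  have p2 := pK₂ z hz.le
  set M := Real.log (K₁ z) - Real.log (K₂ z) - Real.log s with hM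
  have hMpos : 0 < M := by
    have : Real.log (s * K₂ z) < Real.log (K₁ z) := Real.log_lt_log (by positivity) hcon
    rw [Real.log_mul hs.ne' p2.ne'] at this
    rw [hM]; linarith
  set ε := M / 2 with hε
  have hεp : 0 < ε := by positivity
  let H : ℂ → ℝ := fun w => Real.log (K₁ w) - Real.log (K₂ w) + ε * ‖w‖ ^ 2
  have hH : ContinuousOn H (Metric.closedBall 0 1) := by
    refine ((hK₁.continuousOn.log ?_).sub (hK₂.continuousOn.log ?_)).add (by fun_prop)
    · intro x hx; exact (pK₁ x (by simpa using hx)).ne'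
    · intro x hx; exact (pK₂ x (by simpa using hx)).ne'
  obtain ⟨w, hw, hmax⟩ := (isCompact_closedBall (0:ℂ) 1).exists_isMaxOn ⟨0, by simp⟩ hH
  have hw' : ‖w‖ ≤ 1 := by simpa using hw
  have hzw : H z ≤ H w := hmax (by simpa using hz.le)
  have hHz : M + Real.log s ≤ H z := by
    have : 0 ≤ ε * ‖z‖ ^ 2 := by positivity
    simp only [H, hM]; linarith
  have hw1 : ‖w‖ < 1 := by
    rcases hw'.lt_or_eq with h | h
    · exact h
    · exfalso
      have : H w = Real.log s + ε := by
        simp only [H, h, hb w h]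
        rw [Real.log_mul hs.ne' (pK₂ w hw').ne']; ring
      linarith
  have hpos : ∀ y : ℂ, ‖y‖ < 1 → 0 < 1 - ‖y‖ ^ 2 := by
    intro y hy; nlinarith [norm_nonneg y]
  have q1 := pK₁ w hw'
  have q2 := pK₂ w hw'
  have q3 := hpos w hw1
  refine aux_interior P₁ Q₁ P₂ Q₂ hP₁ hQ₁ hP₂ hQ₂ w s ε hεp hs ?_ ?_ ?_ (hW w hw1) ?_
  · rw [hv₁]; positivity
  · rw [hv₂]; positivity
  · rw [hv₁, hv₂]
    have : Real.log (s * K₂ w) ≤ Real.log (K₁ w) := by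
      rw [Real.log_mul hs.ne' q2.ne']
      have : ε * ‖w‖ ^ 2 ≤ ε := by nlinarith
      have h3 : H w = Real.log (K₁ w) - Real.log (K₂ w) + ε * ‖w‖ ^ 2 := rfl
      linarith
    have := (Real.log_le_log_iff (by positivity) q1).mp this
    nlinarith
  · have hopen : ∀ᶠ y in nhds w, ‖y‖ < 1 := continuous_norm.continuousAt.eventually (gt_mem_nhds hw1)
    have e : ∀ y : ℂ, ‖y‖ < 1 → Real.log (‖Q₁ y‖ ^ 2 - ‖P₁ y‖ ^ 2)
      - Real.log (‖Q₂ y‖ ^ 2 - ‖P₂ y‖ ^ 2) + ε * ‖y‖ ^ 2 = H y := by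
      intro y hy
      rw [hv₁, hv₂, Real.log_mul (hpos y hy).ne' (pK₁ y hy.le).ne',
        Real.log_mul (hpos y hy).ne' (pK₂ y hy.le).ne']
      simp only [H]; ring
    filter_upwards [hopen] with y hy
    rw [e y hy, e w hw1]
    exact hmax (by simpa using hy.le)

/-- An entire function vanishing at small reals vanishes. -/
theorem aux_real_zero (f : ℂ → ℂ) (hf : Differentiable ℂ f)
    (h : ∀ t : ℝ, |t| < 1 / 2 → f t = 0) : ∀ z, f z = 0 := by
  have h1 : AnalyticOnNhd ℂ f Set.univ := fun z _ => hf.analyticAt z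
  have h2 : AnalyticOnNhd ℂ (fun _ : ℂ => (0 : ℂ)) Set.univ := fun z _ => analyticAt_const
  have hfr : ∃ᶠ z in nhdsWithin (0:ℂ) {0}ᶜ, f z = (fun _ : ℂ => (0:ℂ)) z := by
    have ht : Filter.Tendsto (fun t : ℝ => (t : ℂ)) (nhdsWithin 0 {0}ᶜ) (nhdsWithin (0:ℂ) {0}ᶜ) := by
      refine tendsto_nhdsWithin_iff.mpr ⟨?_, ?_⟩
      · have : ContinuousAt (fun t : ℝ => (t : ℂ)) 0 := by fun_prop
        have := this.tendsto
        simp only [Complex.ofReal_zero] at this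
        exact this.mono_left nhdsWithin_le_nhds
      · filter_upwards [self_mem_nhdsWithin] with t ht
        simpa using ht
    refine ht.frequently (Filter.Eventually.frequently ?_)
    have : ∀ᶠ t : ℝ in nhds 0, |t| < 1 / 2 := by
      have : ContinuousAt (fun t : ℝ => |t|) 0 := by fun_prop
      exact this.eventually (gt_mem_nhds (by simp))
    filter_upwards [nhdsWithin_le_nhds this] with t ht
    exact h t ht
  have := h1.eq_of_frequently_eq h2 hfr
  intro z
  rw [this]

/-- Polarization. `f i` entire with conjugate `fs i`. -/
theorem aux_polar (P₁ Q₁ P₂ Q₂ R₁ S₁ R₂ S₂ : ℂ → ℂ) (hP₁ : Differentiable ℂ P₁)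
    (hQ₁ : Differentiable ℂ Q₁) (hP₂ : Differentiable ℂ P₂) (hQ₂ : Differentiable ℂ Q₂)
    (hR₁ : Differentiable ℂ R₁)
    (hS₁ : Differentiable ℂ S₁) (hR₂ : Differentiable ℂ R₂) (hS₂ : Differentiable ℂ S₂)
    (cP₁ : ∀ z, R₁ (conj z) = conj (P₁ z)) (cQ₁ : ∀ z, S₁ (conj z) = conj (Q₁ z))
    (cP₂ : ∀ z, R₂ (conj z) = conj (P₂ z)) (cQ₂ : ∀ z, S₂ (conj z) = conj (Q₂ z)) (s : ℝ)
    (h : ∀ z, ‖z‖ < 1 → ‖Q₁ z‖ ^ 2 - ‖P₁ z‖ ^ 2 = s * (‖Q₂ z‖ ^ 2 - ‖P₂ z‖ ^ 2)) (z w : ℂ) :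
    Q₁ z * conj (Q₁ w) - P₁ z * conj (P₁ w) = s * (Q₂ z * conj (Q₂ w) - P₂ z * conj (P₂ w)) := by
  let G : ℂ → ℂ → ℂ := fun x y => Q₁ (x + I * y) * S₁ (x - I * y) - P₁ (x + I * y) * R₁ (x - I * y)
    - s * (Q₂ (x + I * y) * S₂ (x - I * y) - P₂ (x + I * y) * R₂ (x - I * y))
  have h0 : ∀ x y : ℝ, |x| < 1 / 2 → |y| < 1 / 2 → G x y = 0 := by
    intro x y hx hy
    have e : (x : ℂ) - I * y = conj ((x : ℂ) + I * y) := by simp; ring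
    have hn : ‖(x : ℂ) + I * y‖ < 1 := by
      calc _ ≤ ‖(x:ℂ)‖ + ‖I * y‖ := norm_add_le _ _
        _ = |x| + |y| := by simp
        _ < 1 := by linarith
    have := h _ hn
    simp only [G, e, cP₁, cQ₁, cP₂, cQ₂, Complex.mul_conj, Complex.normSq_eq_norm_sq]
    rw [sub_eq_zero]
    exact_mod_cast this
  have h1 : ∀ x : ℝ, |x| < 1 / 2 → ∀ y, G x y = 0 := by
    intro x hx
    exact aux_real_zero _ (by simp only [G]; fun_prop) (fun t ht => h0 x t hx ht)
  have h2 : ∀ x y, G x y = 0 := by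
    intro x y
    exact aux_real_zero (fun x => G x y) (by simp only [G]; fun_prop) (fun t ht => h1 t ht y) x
  have h3 := h2 ((z + conj w) / 2) ((z - conj w) / (2 * I))
  have e1 : (z + conj w) / 2 + I * ((z - conj w) / (2 * I)) = z := by
    field_simp; ring
  have e2 : (z + conj w) / 2 - I * ((z - conj w) / (2 * I)) = conj w := by
    field_simp; ring
  simp only [G, e1, e2, cP₁, cQ₁, cP₂, cQ₂] at h3
  exact sub_eq_zero.mp h3

/-- Conclusion from the polarized identity. -/
theorem aux_final (P₁ Q₁ P₂ Q₂ : ℂ → ℂ) (s : ℝ) (hs : 0 < s)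
    (h : ∀ z w, Q₁ z * conj (Q₁ w) - P₁ z * conj (P₁ w)
      = s * (Q₂ z * conj (Q₂ w) - P₂ z * conj (P₂ w)))
    (q₁ : Q₁ 0 = 1) (q₂ : Q₂ 0 = 1) (p₁ : ‖P₁ 0‖ < 1) (p₂ : ‖P₂ 0‖ < 1)
    (n₁ : ∀ z, ‖z‖ < 1 → ‖P₁ z‖ < ‖Q₁ z‖) (n₂ : ∀ z, ‖z‖ < 1 → ‖P₂ z‖ < ‖Q₂ z‖) :
    ∃ (α : ℂ) (θ : ℝ), ‖α‖ < 1 ∧ ∀ z : ℂ, ‖z‖ < 1 →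
      P₂ z / Q₂ z = Complex.exp (θ * Complex.I) * (P₁ z / Q₁ z - α) / (1 - conj α * (P₁ z / Q₁ z)) := by
  set p := P₁ 0 with hp
  set r := P₂ 0 with hr
  have hD : ∀ z, Q₁ z - conj p * P₁ z = s * (Q₂ z - conj r * P₂ z) := by
    intro z
    have := h z 0
    rw [q₁, q₂, ← hp, ← hr] at this
    simp only [map_one, mul_one] at this
    linear_combination this
  have h00 : 1 - conj p * p = s * (1 - conj r * r) := by
    have := hD 0
    rwa [q₁, q₂, ← hp, ← hr] at this
  have hr0 : (1 - conj r * r) ≠ 0 := by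
    rw [mul_comm, Complex.mul_conj, Complex.normSq_eq_norm_sq]
    have : 1 - ‖r‖ ^ 2 ≠ 0 := by nlinarith [norm_nonneg r]
    exact_mod_cast this
  have hN : ∀ z w, (P₁ z - p * Q₁ z) * conj (P₁ w - p * Q₁ w)
      = s ^ 2 * ((P₂ z - r * Q₂ z) * conj (P₂ w - r * Q₂ w)) := by
    intro z w
    have a1 := hD z
    have a2 := congrArg conj (hD w)
    have a3 := h z w
    simp only [map_sub, map_mul, Complex.conj_conj, Complex.conj_ofReal] at a2 ⊢
    linear_combination a1 * (conj (Q₁ w) - p * conj (P₁ w)) + s * (Q₂ z - conj r * P₂ z) * a2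
      - (1 - conj p * p) * a3 - s * (Q₂ z * conj (Q₂ w) - P₂ z * conj (P₂ w)) * h00
  obtain ⟨l, hl, hlN⟩ : ∃ l : ℂ, ‖l‖ = 1 ∧ ∀ z, s * (P₂ z - r * Q₂ z) = l * (P₁ z - p * Q₁ z) := by
    by_cases hz : ∀ z, P₁ z - p * Q₁ z = 0
    · refine ⟨1, by simp, fun z => ?_⟩
      have := hN z z
      rw [hz z, zero_mul] at this
      have hsc : (s : ℂ) ≠ 0 := by exact_mod_cast hs.ne'
      have h2 := (mul_eq_zero.mp this.symm).resolve_left (pow_ne_zero 2 hsc)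
      have h3 : P₂ z - r * Q₂ z = 0 := by
        rw [Complex.mul_conj] at h2
        exact Complex.normSq_eq_zero.mp (by exact_mod_cast h2)
      rw [hz z, h3]; simp
    · push Not at hz
      obtain ⟨w, hw⟩ := hz
      set N₁ := P₁ w - p * Q₁ w with hN₁
      set N₂ := P₂ w - r * Q₂ w with hN₂
      have hsc : (s : ℂ) ≠ 0 := by exact_mod_cast hs.ne'
      have hnn : ‖N₁‖ ^ 2 = s ^ 2 * ‖N₂‖ ^ 2 := by
        have := hN w w
        rw [Complex.mul_conj, Complex.mul_conj, Complex.normSq_eq_norm_sq,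
          Complex.normSq_eq_norm_sq] at this
        exact_mod_cast this
      have hnn' : ‖N₁‖ = s * ‖N₂‖ := by
        rw [← mul_pow] at hnn
        exact (pow_left_inj₀ (norm_nonneg _) (by positivity) two_ne_zero).mp hnn
      have hN1 : 0 < ‖N₁‖ := norm_pos_iff.mpr hw
      have hN2 : N₂ ≠ 0 := by
        intro h0; rw [h0] at hnn'; simp at hnn'; exact hw hnn'
      have hN2c : conj N₂ ≠ 0 := by simpa using hN2
      refine ⟨conj N₁ / (s * conj N₂), ?_, fun z => ?_⟩
      · rw [norm_div, norm_mul, Complex.norm_conj, Complex.norm_conj, Complex.norm_real,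
          Real.norm_of_nonneg hs.le, ← hnn', div_self hN1.ne']
      · have := hN z w
        field_simp
        linear_combination -this
  have hll : l * conj l = 1 := by rw [Complex.mul_conj, Complex.normSq_eq_norm_sq, hl]; simp
  have hmul : ‖r * conj p‖ < 1 := by
    rw [norm_mul, Complex.norm_conj]; nlinarith [norm_nonneg p, norm_nonneg r]
  set d := l - r * conj p with hd
  have hd0 : d ≠ 0 := by
    intro h0
    rw [hd, sub_eq_zero] at h0
    rw [← h0, hl] at hmul; exact lt_irrefl _ hmul
  have hdc : l * conj d = 1 - l * conj r * p := by
    simp only [hd, map_sub, map_mul, Complex.conj_conj]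
    linear_combination hll
  have hdc0 : conj d ≠ 0 := by simpa using hd0
  have hl0 : l ≠ 0 := by intro h0; rw [h0] at hl; simp at hl
  set α := (l * p - r) / d with hα
  have hαc : l * conj d * conj α = conj p - l * conj r := by
    simp only [hα, map_div₀, map_sub, map_mul]
    field_simp
    linear_combination (conj p) * hll
  have hαd : d * α = l * p - r := by rw [hα]; field_simp
  have hu : ‖d / (l * conj d)‖ = 1 := by
    rw [norm_div, norm_mul, hl, Complex.norm_conj, one_mul, div_self (norm_pos_iff.mpr hd0).ne']
  refine ⟨α, Complex.arg (d / (l * conj d)), ?_, ?_⟩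
  · have hdp : 0 < ‖d‖ := norm_pos_iff.mpr hd0
    have e1 : ‖d‖ ^ 2 - ‖l * p - r‖ ^ 2 = (1 - ‖p‖ ^ 2) * (1 - ‖r‖ ^ 2) := by
      have : (‖d‖ ^ 2 - ‖l * p - r‖ ^ 2 : ℂ) = (1 - ‖p‖ ^ 2) * (1 - ‖r‖ ^ 2) := by
        have nn : ∀ x : ℂ, (‖x‖ : ℂ) ^ 2 = x * conj x := by
          intro x; rw [Complex.mul_conj, Complex.normSq_eq_norm_sq]; simp
        simp only [nn, hd, map_sub, map_mul, Complex.conj_conj]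
        linear_combination (1 - p * conj p) * hll
      exact_mod_cast this
    have e2 : 0 < (1 - ‖p‖ ^ 2) * (1 - ‖r‖ ^ 2) :=
      mul_pos (by nlinarith [norm_nonneg p]) (by nlinarith [norm_nonneg r])
    rw [hα, norm_div, div_lt_one hdp]
    nlinarith [norm_nonneg (l * p - r)]
  · intro z hz
    have hexp : Complex.exp ((Complex.arg (d / (l * conj d)) : ℝ) * Complex.I) = d / (l * conj d) := by
      have := Complex.norm_mul_exp_arg_mul_I (d / (l * conj d))
      rwa [hu, Complex.ofReal_one, one_mul] at this
    rw [hexp]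
    have m1 := n₁ z hz
    have m2 := n₂ z hz
    have Q1 : Q₁ z ≠ 0 := norm_pos_iff.mp ((norm_nonneg _).trans_lt m1)
    have Q2 : Q₂ z ≠ 0 := norm_pos_iff.mp ((norm_nonneg _).trans_lt m2)
    have a1 := hD z
    have a2 := hlN z
    have hsc : (s : ℂ) ≠ 0 := by exact_mod_cast hs.ne'
    have b1 : s * (1 - conj r * r) * P₂ z = d * (P₁ z - α * Q₁ z) := by
      have : d * (P₁ z - α * Q₁ z) = d * P₁ z - (l * p - r) * Q₁ z := by rw [← hαd]; ring
      rw [this, hd]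
      linear_combination a2 - r * a1
    have b2 : s * (1 - conj r * r) * Q₂ z = (l * conj d) * (Q₁ z - conj α * P₁ z) := by
      have : (l * conj d) * (Q₁ z - conj α * P₁ z)
        = (1 - l * conj r * p) * Q₁ z - (conj p - l * conj r) * P₁ z := by
        rw [← hαc, ← hdc]; ring
      rw [this]
      linear_combination conj r * a2 - a1
    have hne : Q₁ z - conj α * P₁ z ≠ 0 := by
      intro h0
      rw [h0, mul_zero] at b2
      exact mul_ne_zero (mul_ne_zero hsc hr0) Q2 b2
    have e3 : P₂ z / Q₂ z = (s * (1 - conj r * r) * P₂ z) / (s * (1 - conj r * r) * Q₂ z) := by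
      rw [mul_div_mul_left _ _ (mul_ne_zero hsc hr0)]
    rw [e3, b1, b2]
    have e4 : 1 - conj α * (P₁ z / Q₁ z) = (Q₁ z - conj α * P₁ z) / Q₁ z := by field_simp
    have e5 : P₁ z / Q₁ z - α = (P₁ z - α * Q₁ z) / Q₁ z := by field_simp
    rw [e4, e5]
    field_simp

theorem aux_Q_ne (n : ℕ) (a : Fin n → ℂ) (ha : ∀ k, ‖a k‖ < 1) (z : ℂ) (hz : ‖z‖ ≤ 1) (k : Fin n) :
    1 - conj (a k) * z ≠ 0 := by
  intro h0
  have : ‖conj (a k) * z‖ = 1 := by rw [← sub_eq_zero.mp h0]; simp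
  rw [norm_mul, Complex.norm_conj] at this
  nlinarith [norm_nonneg (a k), norm_nonneg z, ha k]

theorem aux_wronskian (n : ℕ) (a : Fin n → ℂ) (c : ℂ) (B : ℂ → ℂ)
    (hB : ∀ z, B z = c * ∏ k, (z - a k) / (1 - conj (a k) * z)) (z : ℂ)
    (hz : ∀ k, 1 - conj (a k) * z ≠ 0) :
    deriv B z * ∏ k, (1 - conj (a k) * z) ^ 2 =
      deriv (fun z => c * ∏ k, (z - a k)) z * (∏ k, (1 - conj (a k) * z)) -
        (c * ∏ k, (z - a k)) * deriv (fun z => ∏ k, (1 - conj (a k) * z)) z := by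
  have hBe : B = fun z => (c * ∏ k, (z - a k)) / (∏ k, (1 - conj (a k) * z)) := by
    funext y
    rw [hB, Finset.prod_div_distrib, mul_div_assoc]
  have hQ : ∏ k, (1 - conj (a k) * z) ≠ 0 := Finset.prod_ne_zero_iff.mpr (fun k _ => hz k)
  have dP : DifferentiableAt ℂ (fun z => c * ∏ k, (z - a k)) z := by fun_prop
  have dQ : DifferentiableAt ℂ (fun z => ∏ k, (1 - conj (a k) * z)) z := by fun_prop
  have hd := (dP.hasDerivAt.div dQ.hasDerivAt hQ).deriv
  have hd' : deriv B z = _ := (congrArg (fun f => deriv f z) hBe).trans hd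
  rw [hd', Finset.prod_pow, div_mul_cancel₀ _ (pow_ne_zero 2 hQ)]

/-- **Uniqueness (up to disc automorphisms) of a finite Blaschke product with prescribed
critical points.** If `B₁` and `B₂` are finite Blaschke products of degree `n` whose
critical points are precisely `ξ 1, …, ξ (n-1)` counted with multiplicity, then
`B₂ = φ ∘ B₁` for some conformal automorphism `φ` of the unit disc. -/
theorem blaschke_unique_up_to_automorphism
    (n : ℕ) (hn : 2 ≤ n) (ξ : Fin (n - 1) → ℂ) (hξ : ∀ j, ‖ξ j‖ < 1)
    (a₁ a₂ : Fin n → ℂ) (ha₁ : ∀ k, ‖a₁ k‖ < 1) (ha₂ : ∀ k, ‖a₂ k‖ < 1)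
    (c₁ c₂ c₁' c₂' : ℂ) (hc₁ : ‖c₁‖ = 1) (hc₂ : ‖c₂‖ = 1)
    (hc₁' : c₁' ≠ 0) (hc₂' : c₂' ≠ 0)
    (B₁ B₂ : ℂ → ℂ)
    (hB₁ : ∀ z, B₁ z = c₁ * ∏ k, (z - a₁ k) / (1 - conj (a₁ k) * z))
    (hB₂ : ∀ z, B₂ z = c₂ * ∏ k, (z - a₂ k) / (1 - conj (a₂ k) * z))
    (hcrit₁ : ∀ z : ℂ, (∀ k, 1 - conj (a₁ k) * z ≠ 0) →
      deriv B₁ z * ∏ k, (1 - conj (a₁ k) * z) ^ 2 =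
        c₁' * ∏ j, (z - ξ j) * (1 - conj (ξ j) * z))
    (hcrit₂ : ∀ z : ℂ, (∀ k, 1 - conj (a₂ k) * z ≠ 0) →
      deriv B₂ z * ∏ k, (1 - conj (a₂ k) * z) ^ 2 =
        c₂' * ∏ j, (z - ξ j) * (1 - conj (ξ j) * z)) :
    ∃ (α : ℂ) (θ : ℝ), ‖α‖ < 1 ∧
      ∀ z : ℂ, ‖z‖ < 1 →
        B₂ z = Complex.exp (θ * Complex.I) * (B₁ z - α) / (1 - conj α * B₁ z) := by
  have hn1 : 1 ≤ n := by omega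
  obtain ⟨K₁, cK₁, v₁, -, pK₁, -, w₁⟩ := aux_struct n a₁ ha₁ c₁ hc₁
  obtain ⟨K₂, cK₂, v₂, -, pK₂, -, w₂⟩ := aux_struct n a₂ ha₂ c₂ hc₂
  have W₁ : ∀ z, ‖z‖ ≤ 1 → _ := fun z hz => (aux_wronskian n a₁ c₁ B₁ hB₁ z
    (aux_Q_ne n a₁ ha₁ z hz)).symm.trans (hcrit₁ z (aux_Q_ne n a₁ ha₁ z hz))
  have W₂ : ∀ z, ‖z‖ ≤ 1 → _ := fun z hz => (aux_wronskian n a₂ c₂ B₂ hB₂ z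
    (aux_Q_ne n a₂ ha₂ z hz)).symm.trans (hcrit₂ z (aux_Q_ne n a₂ ha₂ z hz))
  have dP₁ : Differentiable ℂ (fun z => c₁ * ∏ k, (z - a₁ k)) := by fun_prop
  have dQ₁ : Differentiable ℂ (fun z => ∏ k, (1 - conj (a₁ k) * z)) := by fun_prop
  have dP₂ : Differentiable ℂ (fun z => c₂ * ∏ k, (z - a₂ k)) := by fun_prop
  have dQ₂ : Differentiable ℂ (fun z => ∏ k, (1 - conj (a₂ k) * z)) := by fun_prop
  have dR₁ : Differentiable ℂ (fun z => conj c₁ * ∏ k, (z - conj (a₁ k))) := by fun_prop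
  have dS₁ : Differentiable ℂ (fun z => ∏ k, (1 - a₁ k * z)) := by fun_prop
  have dR₂ : Differentiable ℂ (fun z => conj c₂ * ∏ k, (z - conj (a₂ k))) := by fun_prop
  have dS₂ : Differentiable ℂ (fun z => ∏ k, (1 - a₂ k * z)) := by fun_prop
  have hBe₁ : ∀ z, B₁ z = (c₁ * ∏ k, (z - a₁ k)) / (∏ k, (1 - conj (a₁ k) * z)) := by
    intro y
    rw [hB₁, Finset.prod_div_distrib, mul_div_assoc]
  have hBe₂ : ∀ z, B₂ z = (c₂ * ∏ k, (z - a₂ k)) / (∏ k, (1 - conj (a₂ k) * z)) := by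
    intro y
    rw [hB₂, Finset.prod_div_distrib, mul_div_assoc]
  have cR₁ : ∀ z, (fun z => conj c₁ * ∏ k, (z - conj (a₁ k))) (conj z)
      = conj ((fun z => c₁ * ∏ k, (z - a₁ k)) z) := by intro z; simp
  have cS₁ : ∀ z, (fun z => ∏ k, (1 - a₁ k * z)) (conj z)
      = conj ((fun z => ∏ k, (1 - conj (a₁ k) * z)) z) := by intro z; simp
  have cR₂ : ∀ z, (fun z => conj c₂ * ∏ k, (z - conj (a₂ k))) (conj z)
      = conj ((fun z => c₂ * ∏ k, (z - a₂ k)) z) := by intro z; simp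
  have cS₂ : ∀ z, (fun z => ∏ k, (1 - a₂ k * z)) (conj z)
      = conj ((fun z => ∏ k, (1 - conj (a₂ k) * z)) z) := by intro z; simp
  have q₁ : (fun z => ∏ k, (1 - conj (a₁ k) * z)) 0 = 1 := by simp
  have q₂ : (fun z => ∏ k, (1 - conj (a₂ k) * z)) 0 = 1 := by simp
  set P₁ : ℂ → ℂ := fun z => c₁ * ∏ k, (z - a₁ k) with hP₁
  set Q₁ : ℂ → ℂ := fun z => ∏ k, (1 - conj (a₁ k) * z) with hQ₁
  set P₂ : ℂ → ℂ := fun z => c₂ * ∏ k, (z - a₂ k) with hP₂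
  set Q₂ : ℂ → ℂ := fun z => ∏ k, (1 - conj (a₂ k) * z) with hQ₂
  have hs1 : 0 < ‖c₁'‖ := norm_pos_iff.mpr hc₁'
  have hs2 : 0 < ‖c₂'‖ := norm_pos_iff.mpr hc₂'
  have hs : 0 < ‖c₁'‖ / ‖c₂'‖ := by positivity
  have hW : ∀ z, ‖z‖ ≤ 1 → ‖deriv P₁ z * Q₁ z - P₁ z * deriv Q₁ z‖
      = ‖c₁'‖ / ‖c₂'‖ * ‖deriv P₂ z * Q₂ z - P₂ z * deriv Q₂ z‖ := by
    intro z hz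
    have e1 : deriv P₁ z * Q₁ z - P₁ z * deriv Q₁ z = _ := W₁ z hz
    have e2 : deriv P₂ z * Q₂ z - P₂ z * deriv Q₂ z = _ := W₂ z hz
    rw [e1, e2, norm_mul, norm_mul]
    field_simp
  have k₁ : ∀ z, ‖z‖ = 1 → ‖deriv P₁ z * Q₁ z - P₁ z * deriv Q₁ z‖ = K₁ z := by
    intro z hz
    have e : z * (deriv P₁ z * Q₁ z - P₁ z * deriv Q₁ z) = c₁ * z ^ n * (K₁ z : ℝ) := w₁ z hz
    have e' := congrArg norm e
    simpa [hz, hc₁, abs_of_pos (pK₁ z hz.le hn1)] using e'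
  have k₂ : ∀ z, ‖z‖ = 1 → ‖deriv P₂ z * Q₂ z - P₂ z * deriv Q₂ z‖ = K₂ z := by
    intro z hz
    have e : z * (deriv P₂ z * Q₂ z - P₂ z * deriv Q₂ z) = c₂ * z ^ n * (K₂ z : ℝ) := w₂ z hz
    have e' := congrArg norm e
    simpa [hz, hc₂, abs_of_pos (pK₂ z hz.le hn1)] using e'
  have hb : ∀ z, ‖z‖ = 1 → K₁ z = ‖c₁'‖ / ‖c₂'‖ * K₂ z := by
    intro z hz
    rw [← k₁ z hz, ← k₂ z hz, hW z hz.le]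
  have hKle : ∀ z, ‖z‖ < 1 → K₁ z ≤ ‖c₁'‖ / ‖c₂'‖ * K₂ z := fun z hz =>
    aux_max P₁ Q₁ P₂ Q₂ dP₁ dQ₁ dP₂ dQ₂ _ hs K₁ K₂ cK₁ cK₂ (fun z hz => pK₁ z hz hn1)
      (fun z hz => pK₂ z hz hn1) v₁ v₂ hb (fun z hz => hW z hz.le) z hz
  have hKge : ∀ z, ‖z‖ < 1 → K₂ z ≤ (‖c₁'‖ / ‖c₂'‖)⁻¹ * K₁ z := fun z hz =>
    aux_max P₂ Q₂ P₁ Q₁ dP₂ dQ₂ dP₁ dQ₁ _ (inv_pos.mpr hs) K₂ K₁ cK₂ cK₁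
      (fun z hz => pK₂ z hz hn1) (fun z hz => pK₁ z hz hn1) v₂ v₁
      (fun z hz => by rw [hb z hz, inv_mul_cancel_left₀ hs.ne'])
      (fun z hz => by rw [hW z hz.le, inv_mul_cancel_left₀ hs.ne']) z hz
  have hK : ∀ z, ‖z‖ < 1 → K₁ z = ‖c₁'‖ / ‖c₂'‖ * K₂ z := by
    intro z hz
    refine le_antisymm (hKle z hz) ?_
    have := mul_le_mul_of_nonneg_left (hKge z hz) hs.le
    rwa [mul_inv_cancel_left₀ hs.ne'] at this
  have v₁' : ∀ z, ‖Q₁ z‖ ^ 2 - ‖P₁ z‖ ^ 2 = (1 - ‖z‖ ^ 2) * K₁ z := v₁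
  have v₂' : ∀ z, ‖Q₂ z‖ ^ 2 - ‖P₂ z‖ ^ 2 = (1 - ‖z‖ ^ 2) * K₂ z := v₂
  have hpol := aux_polar P₁ Q₁ P₂ Q₂ _ _ _ _ dP₁ dQ₁ dP₂ dQ₂ dR₁ dS₁ dR₂ dS₂ cR₁ cS₁ cR₂ cS₂
    (‖c₁'‖ / ‖c₂'‖) (fun z hz => by rw [v₁', v₂', hK z hz]; ring)
  have n₁ : ∀ z, ‖z‖ < 1 → ‖P₁ z‖ < ‖Q₁ z‖ := by
    intro z hz
    have h1 := pK₁ z hz.le hn1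
    have h2 : 0 < 1 - ‖z‖ ^ 2 := by nlinarith [norm_nonneg z]
    have h3 := mul_pos h2 h1
    rw [← v₁'] at h3
    exact lt_of_pow_lt_pow_left₀ 2 (norm_nonneg _) (by linarith)
  have n₂ : ∀ z, ‖z‖ < 1 → ‖P₂ z‖ < ‖Q₂ z‖ := by
    intro z hz
    have h1 := pK₂ z hz.le hn1
    have h2 : 0 < 1 - ‖z‖ ^ 2 := by nlinarith [norm_nonneg z]
    have h3 := mul_pos h2 h1
    rw [← v₂'] at h3
    exact lt_of_pow_lt_pow_left₀ 2 (norm_nonneg _) (by linarith)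
  have p₁ : ‖P₁ 0‖ < 1 := by
    have := n₁ 0 (by simp)
    rwa [q₁, norm_one] at this
  have p₂ : ‖P₂ 0‖ < 1 := by
    have := n₂ 0 (by simp)
    rwa [q₂, norm_one] at this
  obtain ⟨α, θ, hα, hfin⟩ := aux_final P₁ Q₁ P₂ Q₂ _ hs hpol q₁ q₂ p₁ p₂ n₁ n₂
  refine ⟨α, θ, hα, fun z hz => ?_⟩
  rw [hBe₁, hBe₂]
  exact hfin z hz
end

section
/- Let n ≥ 2. (a) If B is a finite Blaschke product of degree n with B(1) = -1, then there exist real numbers x_1 < x_2 < … < x_n and positive real numbers r_1, …, r_n such that the function f(w) = -∑_{k=1}^n r_k/(w - x_k) satisfies f(T(z)) = T(B(z)) for every z ∈ 𝔻 with B(z) ≠ 1. (b) Conversely, for any real numbers x_1 < x_2 < … < x_n and any r_1, …, r_n > 0, setting f(w) = -∑_{k=1}^n r_k/(w - x_k), the function B(z) := T⁻¹(f(T(z))) extends to a finite Blaschke product of degree n with B(1) = -1. -/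
open Complex ComplexConjugate Finset

/-- The (inverse) Cayley transform `T(z) = i(1+z)/(1-z)`, mapping the unit disc onto
the upper half-plane. -/
noncomputable def T (z : ℂ) : ℂ := Complex.I * (1 + z) / (1 - z)

/-- The inverse of `T`, namely `T⁻¹(w) = (w - i)/(w + i)`. -/
noncomputable def Tinv (w : ℂ) : ℂ := (w - Complex.I) / (w + Complex.I)

/-- A finite Blaschke product with zeros `a k` and unimodular constant `c`. -/
noncomputable def blaschke {n : ℕ} (c : ℂ) (a : Fin n → ℂ) (z : ℂ) : ℂ :=
  c * ∏ k, (z - a k) / (1 - conj (a k) * z)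

open Polynomial in
theorem aux_prod_lt {n : ℕ} (hn : 0 < n) (f g : Fin n → ℝ) (hf : ∀ k, 0 ≤ f k)
    (hfg : ∀ k, f k < g k) : ∏ k, f k < ∏ k, g k := by
  by_cases h : ∃ k, f k = 0
  · obtain ⟨k, hk⟩ := h
    rw [Finset.prod_eq_zero (Finset.mem_univ k) hk]
    exact Finset.prod_pos fun i _ => (hf i).trans_lt (hfg i)
  · push Not at h
    have : Nonempty (Fin n) := ⟨⟨0, hn⟩⟩
    exact Finset.prod_lt_prod_of_nonempty (fun i _ => lt_of_le_of_ne (hf i) (h i).symm)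
      (fun i _ => hfg i) Finset.univ_nonempty

theorem aux_norm_sub_lt {w b : ℂ} (hw : 0 < w.im) (hb : 0 < b.im) :
    ‖w - b‖ < ‖w - conj b‖ := by
  rw [← sq_lt_sq₀ (norm_nonneg _) (norm_nonneg _), ← Complex.normSq_eq_norm_sq,
    ← Complex.normSq_eq_norm_sq, Complex.normSq_apply, Complex.normSq_apply]
  simp
  nlinarith [mul_pos hw hb]

theorem aux_norm_prod_lt {n : ℕ} (hn : 0 < n) (b : Fin n → ℂ) (hb : ∀ k, 0 < (b k).im)
    {w : ℂ} (hw : 0 < w.im) : ‖∏ k, (w - b k)‖ < ‖∏ k, (w - conj (b k))‖ := by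
  rw [norm_prod, norm_prod]
  exact aux_prod_lt hn _ _ (fun k => norm_nonneg _) fun k => aux_norm_sub_lt hw (hb k)

theorem aux_conj_prod {n : ℕ} (b : Fin n → ℂ) (w : ℂ) :
    ∏ k, (conj w - conj (b k)) = conj (∏ k, (w - b k)) := by
  simp [map_prod]

theorem aux_conj_prod' {n : ℕ} (b : Fin n → ℂ) (w : ℂ) :
    ∏ k, (conj w - b k) = conj (∏ k, (w - conj (b k))) := by
  simp [map_prod]

theorem aux_im_eq_zero {n : ℕ} (hn : 0 < n) (b : Fin n → ℂ) (hb : ∀ k, 0 < (b k).im)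
    {w : ℂ} (h : ∏ k, (w - b k) + ∏ k, (w - conj (b k)) = 0) : w.im = 0 := by
  have h1 : ‖∏ k, (w - b k)‖ = ‖∏ k, (w - conj (b k))‖ := by
    rw [eq_neg_of_add_eq_zero_left h, norm_neg]
  rcases lt_trichotomy w.im 0 with hw | hw | hw
  · have := aux_norm_prod_lt hn b hb (w := conj w) (by simpa using hw)
    rw [aux_conj_prod, aux_conj_prod', Complex.norm_conj, Complex.norm_conj] at this
    linarith
  · exact hw
  · have := aux_norm_prod_lt hn b hb hw
    linarith

open Polynomial in
theorem aux_deriv_prod {n : ℕ} (b : Fin n → ℂ) (x : ℂ) (h : ∀ k, x - b k ≠ 0) :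
    (derivative (∏ k, (X - C (b k)))).eval x = (∏ k, (x - b k)) * ∑ k, (x - b k)⁻¹ := by
  rw [derivative_prod_finset, eval_finsetSum, Finset.mul_sum]
  refine Finset.sum_congr rfl fun k _ => ?_
  rw [← Finset.mul_prod_erase Finset.univ (fun k => x - b k) (Finset.mem_univ k)]
  simp only [derivative_sub, derivative_X, derivative_C, sub_zero, mul_one, eval_prod, eval_sub,
    eval_X, eval_C]
  field_simp [h k]

theorem aux_sum_inv {n : ℕ} (b : Fin n → ℂ) (x : ℝ) :
    ∑ k, ((x : ℂ) - b k)⁻¹ - ∑ k, ((x : ℂ) - conj (b k))⁻¹ =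
      2 * I * ((∑ k, (b k).im / Complex.normSq (x - b k) : ℝ) : ℂ) := by
  rw [← Finset.sum_sub_distrib]
  push_cast
  rw [Finset.mul_sum]
  refine Finset.sum_congr rfl fun k _ => ?_
  have h : ((x : ℂ) - conj (b k)) = conj ((x : ℂ) - b k) := by simp
  rw [h, ← map_inv₀, Complex.sub_conj, Complex.inv_im]
  simp
  ring

open Polynomial in
theorem core_a {n : ℕ} (hn : 0 < n) (b : Fin n → ℂ) (hb : ∀ k, 0 < (b k).im) :
    ∃ (x r : Fin n → ℝ), StrictMono x ∧ (∀ k, 0 < r k) ∧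
      ∀ w : ℂ, 0 < w.im → (-∑ k, (r k : ℂ) / (w - (x k : ℂ))) =
        T (-∏ k, (w - b k) / (w - conj (b k))) := by
  set P : ℂ[X] := ∏ k, (X - C (b k)) with hP
  set Q : ℂ[X] := ∏ k, (X - C (conj (b k))) with hQ
  have hPm : P.Monic := monic_prod_of_monic _ _ fun k _ => monic_X_sub_C _
  have hQm : Q.Monic := monic_prod_of_monic _ _ fun k _ => monic_X_sub_C _
  have hPd : P.natDegree = n := by simp [hP]
  have hQd : Q.natDegree = n := by simp [hQ]
  have hPe : ∀ w, P.eval w = ∏ k, (w - b k) := fun w => by simp [hP, eval_prod]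
  have hQe : ∀ w, Q.eval w = ∏ k, (w - conj (b k)) := fun w => by simp [hQ, eval_prod]
  have hPd' : P.degree = n := by rw [degree_eq_natDegree hPm.ne_zero, hPd]
  have hQd' : Q.degree = n := by rw [degree_eq_natDegree hQm.ne_zero, hQd]
  have hDdeg : (Q - P).degree < n := by
    rw [← hQd']
    exact degree_sub_lt_left (by rw [hPd', hQd']) hQm.ne_zero (by rw [hPm.leadingCoeff, hQm.leadingCoeff])
  -- R = (P+Q)/2
  set R : ℂ[X] := P + C (1/2) * (Q - P) with hR
  have hDdeg' : (C (1/2 : ℂ) * (Q - P)).degree < P.degree := by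
    rw [hPd']
    rw [degree_C_mul (by norm_num)]
    exact hDdeg
  have hRm : R.Monic := hPm.add_of_left hDdeg'
  have hRd' : R.degree = n := by rw [hR, degree_add_eq_left_of_degree_lt hDdeg', hPd']
  have hRd : R.natDegree = n := natDegree_eq_of_degree_eq_some hRd'
  have hRe : ∀ w, R.eval w = (P.eval w + Q.eval w) / 2 := fun w => by
    simp [hR]; ring
  have hreal : ∀ w, R.eval w = 0 → w.im = 0 := fun w hw => by
    apply aux_im_eq_zero hn b hb
    rw [← hPe, ← hQe]
    rw [hRe] at hw
    linear_combination 2 * hw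
  have hxb : ∀ (x : ℝ) k, (x : ℂ) - b k ≠ 0 := fun x k h => by
    have := congrArg Complex.im h
    simp at this
    exact (hb k).ne' this
  have hxb' : ∀ (x : ℝ) k, (x : ℂ) - conj (b k) ≠ 0 := fun x k h => by
    have := congrArg Complex.im h
    simp at this
    exact (hb k).ne' this
  set σ : ℝ → ℝ := fun x => ∑ k, (b k).im / Complex.normSq (x - b k) with hσ
  have hσpos : ∀ x, 0 < σ x := fun x => by
    have : Nonempty (Fin n) := ⟨⟨0, hn⟩⟩
    exact Finset.sum_pos (fun k _ => div_pos (hb k) (Complex.normSq_pos.2 (hxb x k)))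
      Finset.univ_nonempty
  have hPne : ∀ x : ℝ, P.eval (x : ℂ) ≠ 0 := fun x => by
    rw [hPe]; exact Finset.prod_ne_zero_iff.2 fun k _ => hxb x k
  have hRder : ∀ x : ℝ, R.eval (x : ℂ) = 0 →
      (derivative R).eval (x : ℂ) = I * P.eval (x : ℂ) * σ x := fun x hx => by
    have h1 : Q.eval (x : ℂ) = - P.eval (x : ℂ) := by
      rw [hRe] at hx
      linear_combination 2 * hx
    have h2 : (derivative P).eval (x : ℂ) = P.eval (x : ℂ) * ∑ k, ((x : ℂ) - b k)⁻¹ := by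
      rw [hPe]; exact aux_deriv_prod b x (hxb x)
    have h3 : (derivative Q).eval (x : ℂ) = Q.eval (x : ℂ) * ∑ k, ((x : ℂ) - conj (b k))⁻¹ := by
      rw [hQe]; exact aux_deriv_prod (fun k => conj (b k)) x (hxb' x)
    have h4 := aux_sum_inv b x
    have h5 : (derivative R).eval (x : ℂ) =
        ((derivative P).eval (x : ℂ) + (derivative Q).eval (x : ℂ)) / 2 := by
      simp [hR]; ring
    rw [h5, h2, h3, h1]
    linear_combination (P.eval (x : ℂ) / 2) * h4
  have hRne : ∀ x : ℝ, R.eval (x : ℂ) = 0 → (derivative R).eval (x : ℂ) ≠ 0 := fun x hx => by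
    rw [hRder x hx]
    exact mul_ne_zero (mul_ne_zero I_ne_zero (hPne x)) (ofReal_ne_zero.2 (hσpos x).ne')
  have hnod : R.roots.Nodup := by
    rw [Multiset.nodup_iff_count_le_one]
    intro w
    rw [count_roots]
    by_contra hlt
    push Not at hlt
    obtain ⟨hw1, hw2⟩ := (one_lt_rootMultiplicity_iff_isRoot hRm.ne_zero).1 hlt
    have him := hreal w hw1
    have hwr : w = (w.re : ℂ) := Complex.ext (by simp) (by simp [him])
    rw [hwr] at hw1 hw2
    exact hRne _ hw1 hw2
  have hcard : R.roots.toFinset.card = n := by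
    rw [Multiset.toFinset_card_of_nodup hnod, ← (IsAlgClosed.splits R).natDegree_eq_card_roots, hRd]
  have hroot : ∀ w ∈ R.roots.toFinset, R.eval w = 0 := fun w hw => by
    rw [Multiset.mem_toFinset, mem_roots hRm.ne_zero] at hw
    exact hw
  set s : Finset ℝ := R.roots.toFinset.image Complex.re with hs
  have hscard : s.card = n := by
    rw [hs, Finset.card_image_of_injOn, hcard]
    intro u hu v hv huv
    exact Complex.ext huv (by rw [hreal u (hroot u hu), hreal v (hroot v hv)])
  have hsroot : ∀ x ∈ s, R.eval (x : ℂ) = 0 := fun x hx => by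
    obtain ⟨w, hw, rfl⟩ := Finset.mem_image.1 hx
    have hw0 := hroot w hw
    have hwr : w = (w.re : ℂ) := Complex.ext (by simp) (by simp [hreal w hw0])
    rw [← hwr]; exact hw0
  set x : Fin n → ℝ := fun k => s.orderEmbOfFin hscard k with hx
  have hxmono : StrictMono x := (s.orderEmbOfFin hscard).strictMono
  have hxroot : ∀ k, R.eval (x k : ℂ) = 0 := fun k => hsroot _ (s.orderEmbOfFin_mem hscard k)
  set v : Fin n → ℂ := fun k => (x k : ℂ) with hv
  have hvinj : Set.InjOn v (Finset.univ : Finset (Fin n)) := fun i _ j _ hij =>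
    hxmono.injective (ofReal_injective hij)
  have hnodal : Lagrange.nodal Finset.univ v = R := by
    refine eq_of_degree_sub_lt_of_eval_index_eq Finset.univ hvinj ?_ ?_
    · have hd : (Lagrange.nodal Finset.univ v).degree = n := by simp [Lagrange.degree_nodal]
      have := degree_sub_lt_left (p := Lagrange.nodal Finset.univ v) (q := R) (by rw [hd, hRd'])
        (Lagrange.nodal_ne_zero) (by rw [hRm.leadingCoeff, (Lagrange.nodal_monic).leadingCoeff])
      rw [hd] at this
      simpa using this
    · intro i hi
      rw [Lagrange.eval_nodal_at_node hi]
      exact (hxroot i).symm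
  refine ⟨x, fun k => 1 / σ (x k), hxmono, fun k => one_div_pos.2 (hσpos _), ?_⟩
  intro w hw
  have hwx : ∀ k, w - (x k : ℂ) ≠ 0 := fun k h => by
    have := congrArg Complex.im h
    simp at this
    exact hw.ne' this
  have hQw : Q.eval w ≠ 0 := by
    rw [hQe]
    exact norm_pos_iff.1 ((norm_nonneg _).trans_lt (aux_norm_prod_lt hn b hb hw))
  have hRw : R.eval w ≠ 0 := fun h => hw.ne' (hreal w h)
  have hint : (Q - P).eval w = R.eval w *
      ∑ k, ((derivative R).eval (x k : ℂ))⁻¹ * (w - x k)⁻¹ * (Q - P).eval (x k : ℂ) := by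
    have h1 := Lagrange.eq_interpolate (s := Finset.univ) (v := v) (f := Q - P) hvinj
      (by simpa using hDdeg)
    have h2 := congrArg (Polynomial.eval w) h1
    rw [Lagrange.eval_interpolate_not_at_node _ (fun i _ => sub_ne_zero.1 (hwx i)), hnodal] at h2
    rw [h2]
    congr 1
    refine Finset.sum_congr rfl fun k hk => ?_
    rw [Lagrange.nodalWeight_eq_eval_derivative_nodal hk, hnodal]
  have hTB : T (-∏ k, (w - b k) / (w - conj (b k))) = I / 2 * ((Q - P).eval w / R.eval w) := by
    rw [Finset.prod_div_distrib, ← hPe, ← hQe, T, eval_sub]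
    have h2 : P.eval w + Q.eval w = 2 * R.eval w := by rw [hRe]; ring
    have h3 : 1 - -(P.eval w / Q.eval w) = 2 * R.eval w / Q.eval w := by
      rw [← h2]; field_simp; ring
    rw [h3]
    field_simp
    ring
  rw [hTB, hint, mul_div_cancel_left₀ _ hRw, Finset.mul_sum, ← Finset.sum_neg_distrib]
  refine Finset.sum_congr rfl fun k _ => ?_
  have h1 : Q.eval (x k : ℂ) = - P.eval (x k : ℂ) := by
    have := hxroot k
    rw [hRe] at this
    linear_combination 2 * this
  rw [hRder _ (hxroot k), eval_sub, h1]
  have hσ' : (σ (x k) : ℂ) ≠ 0 := ofReal_ne_zero.2 (hσpos _).ne'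
  have hp := hPne (x k)
  have hw' := hwx k
  push_cast
  field_simp
  ring

open Polynomial in
theorem core_b {n : ℕ} (x r : Fin n → ℝ) (hx : StrictMono x) (hr : ∀ k, 0 < r k) :
    ∃ b : Fin n → ℂ, (∀ k, 0 < (b k).im) ∧
      ∀ w : ℂ, 0 < w.im → -∏ k, (w - b k) / (w - conj (b k)) =
        Tinv (-∑ k, (r k : ℂ) / (w - (x k : ℂ))) := by
  set v : Fin n → ℂ := fun k => (x k : ℂ) with hv
  have hvinj : Set.InjOn v (Finset.univ : Finset (Fin n)) := fun i _ j _ hij =>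
    hx.injective (ofReal_injective hij)
  set N : ℂ[X] := Lagrange.nodal Finset.univ v with hN
  set M : ℂ[X] := Lagrange.interpolate Finset.univ v
    (fun k => -(r k : ℂ) / Lagrange.nodalWeight Finset.univ v k) with hM
  set f : ℂ → ℂ := fun w => -∑ k, (r k : ℂ) / (w - (x k : ℂ)) with hf
  have hNd : N.degree = n := by simp [hN, Lagrange.degree_nodal]
  have hNm : N.Monic := Lagrange.nodal_monic
  have hMd : (C I * M).degree < N.degree := by
    rw [hNd]
    rw [degree_C_mul I_ne_zero]
    have h0 : M.degree < ((Finset.univ : Finset (Fin n)).card : WithBot ℕ) :=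
      Lagrange.degree_interpolate_lt _ hvinj
    rwa [Finset.card_univ, Fintype.card_fin] at h0
  have hMe : ∀ w, (∀ k, w ≠ v k) → M.eval w = N.eval w * f w := fun w hw => by
    rw [hM, Lagrange.eval_interpolate_not_at_node _ (fun i _ => hw i), hf]
    simp only
    rw [← Finset.sum_neg_distrib]
    congr 1
    refine Finset.sum_congr rfl fun k hk => ?_
    have h1 := Lagrange.nodalWeight_ne_zero hvinj hk
    have h2 : w - v k ≠ 0 := sub_ne_zero.2 (hw k)
    change _ = -((r k : ℂ) / (w - v k))
    field_simp
  set P : ℂ[X] := N + C I * M with hP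
  have hPm : P.Monic := hNm.add_of_left hMd
  have hPd : P.natDegree = n :=
    natDegree_eq_of_degree_eq_some (by rw [hP, degree_add_eq_left_of_degree_lt hMd, hNd])
  have hPe : ∀ w, (∀ k, w ≠ v k) → P.eval w = N.eval w * (1 + I * f w) := fun w hw => by
    simp [hP, hMe w hw]; ring
  have hPv : ∀ k, P.eval (v k) ≠ 0 := fun k => by
    have h1 : N.eval (v k) = 0 := Lagrange.eval_nodal_at_node (Finset.mem_univ k)
    have h2 : M.eval (v k) = _ := Lagrange.eval_interpolate_at_node _ hvinj (Finset.mem_univ k)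
    simp only [hP, eval_add, eval_mul, eval_C, h1, h2, zero_add]
    refine mul_ne_zero I_ne_zero (div_ne_zero (neg_ne_zero.2 (ofReal_ne_zero.2 (hr k).ne')) ?_)
    exact Lagrange.nodalWeight_ne_zero hvinj (Finset.mem_univ k)
  have hfim : ∀ w, (f w).im = w.im * ∑ k, r k / Complex.normSq (w - x k) := fun w => by
    simp only [hf, Complex.neg_im, Complex.im_sum]
    rw [← Finset.sum_neg_distrib, Finset.mul_sum]
    refine Finset.sum_congr rfl fun k _ => ?_
    rw [Complex.div_im]
    simp
    ring
  have hS : ∀ w : ℂ, 0 ≤ ∑ k, r k / Complex.normSq (w - x k) := fun w =>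
    Finset.sum_nonneg fun k _ => div_nonneg (hr k).le (Complex.normSq_nonneg _)
  have hfconj : ∀ w, f (conj w) = conj (f w) := fun w => by
    simp [hf, map_sum]
  have hNconj : ∀ w, N.eval (conj w) = conj (N.eval w) := fun w => by
    simp [hN, Lagrange.eval_nodal, map_prod, hv]
  have hPim : ∀ w, P.eval w = 0 → 0 < w.im := fun w hw => by
    have hwv : ∀ k, w ≠ v k := fun k h => hPv k (h ▸ hw)
    rw [hPe w hwv] at hw
    have hNw : N.eval w ≠ 0 := by
      rw [hN, Lagrange.eval_nodal]
      exact Finset.prod_ne_zero_iff.2 fun k _ => sub_ne_zero.2 (hwv k)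
    have h1 := (mul_eq_zero.1 hw).resolve_left hNw
    have h2 := congrArg Complex.re h1
    simp only [Complex.add_re, Complex.one_re, Complex.mul_re, Complex.I_re, Complex.I_im,
      Complex.zero_re, zero_mul, one_mul, hfim] at h2
    by_contra hneg
    push Not at hneg
    nlinarith [mul_nonneg (neg_nonneg.2 hneg) (hS w)]
  have hcard : P.roots.toList.length = n := by
    rw [Multiset.length_toList, ← (IsAlgClosed.splits P).natDegree_eq_card_roots, hPd]
  set b : Fin n → ℂ := fun k => P.roots.toList.get (k.cast hcard.symm) with hb
  have hbroot : ∀ k, P.eval (b k) = 0 := fun k => by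
    have : b k ∈ P.roots.toList := List.get_mem _ _
    rw [Multiset.mem_toList, mem_roots hPm.ne_zero] at this
    exact this
  have hprod : ∀ w, ∏ k, (w - b k) = P.eval w := fun w => by
    rw [(IsAlgClosed.splits P).eval_eq_prod_roots_of_monic hPm]
    conv_rhs => rw [← Multiset.coe_toList P.roots, Multiset.map_coe, Multiset.prod_coe]
    rw [← List.prod_ofFn]
    congr 1
    apply List.ext_get
    · simp [hcard]
    · intro i h1 h2
      simp [hb]
  refine ⟨b, fun k => hPim _ (hbroot k), ?_⟩
  intro w hw
  have hwv : ∀ k, w ≠ v k := fun k h => by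
    have := congrArg Complex.im h
    simp [hv] at this
    exact hw.ne' this
  have hwv' : ∀ k, conj w ≠ v k := fun k h => by
    have := congrArg Complex.im h
    simp [hv] at this
    exact hw.ne' this
  have hNw : N.eval w ≠ 0 := by
    rw [hN, Lagrange.eval_nodal]
    exact Finset.prod_ne_zero_iff.2 fun k _ => sub_ne_zero.2 (hwv k)
  have hQ : ∏ k, (w - conj (b k)) = N.eval w * (1 - I * f w) := by
    have h := aux_conj_prod b (conj w)
    rw [Complex.conj_conj, hprod, hPe _ hwv', hNconj, hfconj] at h
    rw [h]
    simp only [map_mul, map_add, map_one, Complex.conj_conj, Complex.conj_I]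
    ring
  have hfI : f w + I ≠ 0 := fun h => by
    have := congrArg Complex.im h
    simp [hfim] at this
    nlinarith [mul_nonneg hw.le (hS w)]
  have hfI' : 1 - I * f w ≠ 0 := fun h => hfI (by
    linear_combination I * h + f w * I_mul_I)
  rw [Finset.prod_div_distrib, hprod, hQ, hPe w hwv, mul_div_mul_left _ _ hNw]
  change _ = Tinv (f w)
  rw [Tinv, ← neg_div, div_eq_div_iff hfI' hfI]
  linear_combination (-2 * f w) * I_mul_I

theorem aux_one_sub_ne {z : ℂ} (hz : ‖z‖ < 1) : 1 - z ≠ 0 := fun h => by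
  rw [← sub_eq_zero.1 h] at hz
  simp at hz

theorem aux_T_im {z : ℂ} (hz : ‖z‖ < 1) : 0 < (T z).im := by
  have h0 : 0 < Complex.normSq (1 - z) := Complex.normSq_pos.2 (aux_one_sub_ne hz)
  have h1 : (T z).im = (1 - Complex.normSq z) / Complex.normSq (1 - z) := by
    rw [T, Complex.div_im]
    field_simp
    simp [Complex.normSq_apply]
    ring
  rw [h1]
  refine div_pos ?_ h0
  rw [Complex.normSq_eq_norm_sq]
  nlinarith [norm_nonneg z]

theorem aux_factor {a z : ℂ} (ha : ‖a‖ < 1) (hz : ‖z‖ < 1) :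
    (z - a) / (1 - conj a * z) =
      (1 - a) / (1 - conj a * 1) * ((T z - T a) / (T z - conj (T a))) := by
  have h1 := aux_one_sub_ne ha
  have h2 := aux_one_sub_ne hz
  have h3 : 1 - conj a ≠ 0 := aux_one_sub_ne (by simpa using ha)
  have h4 : 1 - conj a * z ≠ 0 := aux_one_sub_ne (by
    rw [norm_mul, Complex.norm_conj]
    nlinarith [norm_nonneg a, norm_nonneg z])
  have e1 : T z - T a = 2 * I * (z - a) / ((1 - z) * (1 - a)) := by
    rw [T, T]; field_simp; ring
  have e2 : T z - conj (T a) = 2 * I * (1 - conj a * z) / ((1 - z) * (1 - conj a)) := by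
    rw [T, T]; simp; field_simp; ring
  rw [e1, e2, mul_one]
  field_simp

theorem aux_blaschke {n : ℕ} (c : ℂ) (a : Fin n → ℂ) (ha : ∀ k, ‖a k‖ < 1)
    {z : ℂ} (hz : ‖z‖ < 1) : blaschke c a z =
      blaschke c a 1 * ∏ k, (T z - T (a k)) / (T z - conj (T (a k))) := by
  rw [blaschke, blaschke, mul_assoc, ← Finset.prod_mul_distrib]
  congr 1
  exact Finset.prod_congr rfl fun k _ => aux_factor (ha k) hz

theorem aux_Tinv_norm {b : ℂ} (hb : 0 < b.im) : ‖Tinv b‖ < 1 := by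
  have h := aux_norm_sub_lt hb (b := I) (by simp)
  rw [Complex.conj_I, sub_neg_eq_add] at h
  rw [Tinv, norm_div, div_lt_one ((norm_nonneg _).trans_lt h)]
  exact h

theorem aux_T_Tinv {b : ℂ} (hb : 0 < b.im) : T (Tinv b) = b := by
  have h : b + I ≠ 0 := fun h => by
    have := congrArg Complex.im h
    simp at this
    linarith
  have h1 : 1 - Tinv b = 2 * I / (b + I) := by
    rw [Tinv]; field_simp; ring
  have h2 : 1 + Tinv b = 2 * b / (b + I) := by
    rw [Tinv]; field_simp; ring
  rw [T, h1, h2]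
  field_simp

/-- **Lemma 1.** (a) Every finite Blaschke product `B` of degree `n` with `B(1) = -1`
is transformed by the Cayley transform into a rational function
`f(w) = -∑ r k / (w - x k)` with ordered real poles `x 1 < … < x n` and positive
residues `r k`; (b) conversely every such `f` arises from a finite Blaschke product
of degree `n` with `B(1) = -1`. -/
theorem blaschke_iff_negative_partial_fractions (n : ℕ) (hn : 2 ≤ n) :
    (∀ (a : Fin n → ℂ) (c : ℂ), (∀ k, ‖a k‖ < 1) → ‖c‖ = 1 →
      blaschke c a 1 = -1 →
      ∃ (x r : Fin n → ℝ), StrictMono x ∧ (∀ k, 0 < r k) ∧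
        ∀ z : ℂ, ‖z‖ < 1 → blaschke c a z ≠ 1 →
          (-∑ k, (r k : ℂ) / (T z - (x k : ℂ))) = T (blaschke c a z))
    ∧
    (∀ (x r : Fin n → ℝ), StrictMono x → (∀ k, 0 < r k) →
      ∃ (a : Fin n → ℂ) (c : ℂ), (∀ k, ‖a k‖ < 1) ∧ ‖c‖ = 1 ∧
        blaschke c a 1 = -1 ∧
        ∀ z : ℂ, ‖z‖ < 1 →
          blaschke c a z = Tinv (-∑ k, (r k : ℂ) / (T z - (x k : ℂ)))) := by
  constructor
  · intro a c ha _ hB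
    obtain ⟨x, r, hx, hr, h⟩ := core_a (by omega) (fun k => T (a k)) (fun k => aux_T_im (ha k))
    refine ⟨x, r, hx, hr, fun z hz _ => ?_⟩
    rw [h _ (aux_T_im hz), aux_blaschke c a ha hz, hB, neg_one_mul]
  · intro x r hx hr
    obtain ⟨b, hb, h⟩ := core_b x r hx hr
    have ha : ∀ k, ‖Tinv (b k)‖ < 1 := fun k => aux_Tinv_norm (hb k)
    set u : ℂ := ∏ k, (1 - Tinv (b k)) / (1 - conj (Tinv (b k)) * 1) with hu
    have hun : ‖u‖ = 1 := by
      rw [hu, norm_prod]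
      refine Finset.prod_eq_one fun k _ => ?_
      have e : 1 - conj (Tinv (b k)) * 1 = conj (1 - Tinv (b k)) := by simp
      rw [e, norm_div, Complex.norm_conj]
      exact div_self (norm_ne_zero_iff.2 (aux_one_sub_ne (ha k)))
    have hu0 : u ≠ 0 := norm_ne_zero_iff.1 (by rw [hun]; exact one_ne_zero)
    have hB1 : blaschke (-u⁻¹) (fun k => Tinv (b k)) 1 = -1 := by
      rw [blaschke, ← hu, neg_mul, inv_mul_cancel₀ hu0]
    refine ⟨fun k => Tinv (b k), -u⁻¹, ha, by rw [norm_neg, norm_inv, hun, inv_one], hB1, ?_⟩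
    intro z hz
    rw [aux_blaschke _ _ ha hz, hB1, neg_one_mul, ← h _ (aux_T_im hz)]
    simp only [aux_T_Tinv (hb _)]
end

section
/- Let n ≥ 2 and let c = (c_0, …, c_{2n-2}) ∈ ℝ^{2n-1} be such that the Hankel matrix H(c) is positive definite. Then there exist unique reals t_1 < t_2 < … < t_{n-1}, unique weights σ_1, …, σ_{n-1} > 0, and a unique λ > 0 such that c_k = ∑_{j=1}^{n-1} σ_j·t_j^k for k = 0, …, 2n-3 and c_{2n-2} = ∑_{j=1}^{n-1} σ_j·t_j^{2n-2} + λ. -/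
open Finset

/-- The `n × n` Hankel matrix `H(c)` associated with `c = (c_0, …, c_{2n-2})`,
with entries `H(c)_{ij} = c_{i+j}`. -/
def hankel (n : ℕ) (c : Fin (2 * n - 1) → ℝ) : Matrix (Fin n) (Fin n) ℝ :=
  Matrix.of fun i j =>
    c ⟨(i : ℕ) + (j : ℕ), by have hi := i.isLt; have hj := j.isLt; omega⟩

open Polynomial in
theorem cr_exists_orth (m : ℕ) (L : ℝ[X] →ₗ[ℝ] ℝ)
    (hL : ∀ p : ℝ[X], p ≠ 0 → p.natDegree ≤ m → 0 < L (p * p)) :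
    ∃ P : ℝ[X], P.Monic ∧ P.natDegree = m ∧ ∀ q : ℝ[X], q.degree < m → L (P * q) = 0 := by
  let B : degreeLT ℝ m →ₗ[ℝ] Module.Dual ℝ (degreeLT ℝ m) :=
    LinearMap.mk₂ ℝ (fun p q => L ((p : ℝ[X]) * (q : ℝ[X])))
      (by intros; simp [add_mul]) (by intros; simp) (by intros; simp [mul_add]) (by intros; simp)
  have : FiniteDimensional ℝ (degreeLT ℝ m) :=
    Module.Finite.equiv (degreeLTEquiv ℝ m).symm
  have hinj : Function.Injective B := by
    rw [injective_iff_map_eq_zero]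
    intro p hp
    by_contra hne
    have h1 : L ((p : ℝ[X]) * p) = 0 := by
      have := LinearMap.congr_fun hp p
      simpa [B] using this
    have h2 : (p : ℝ[X]) ≠ 0 := by simpa using hne
    have h3 : (p : ℝ[X]).natDegree ≤ m :=
      natDegree_le_of_degree_le (mem_degreeLT.1 p.2).le
    have := hL _ h2 h3
    linarith
  have hsurj : Function.Surjective B :=
    (LinearMap.injective_iff_surjective_of_finrank_eq_finrank
      (Subspace.dual_finrank_eq).symm).1 hinj
  let φ : Module.Dual ℝ (degreeLT ℝ m) :=
    (L ∘ₗ (LinearMap.mulLeft ℝ (X ^ m : ℝ[X]))) ∘ₗ (degreeLT ℝ m).subtype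
  obtain ⟨r, hr⟩ := hsurj φ
  have hrd : (r : ℝ[X]).degree < m := mem_degreeLT.1 r.2
  refine ⟨X ^ m - (r : ℝ[X]), monic_X_pow_sub hrd, ?_, ?_⟩
  · apply natDegree_eq_of_degree_eq_some
    rw [degree_sub_eq_left_of_degree_lt, degree_X_pow]
    rwa [degree_X_pow]
  · intro q hq
    have := LinearMap.congr_fun hr ⟨q, mem_degreeLT.2 hq⟩
    simp [B, φ] at this
    rw [sub_mul, map_sub, this, sub_self]

open Polynomial in
theorem cr_unique_orth (m : ℕ) (L : ℝ[X] →ₗ[ℝ] ℝ)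
    (hL : ∀ p : ℝ[X], p ≠ 0 → p.natDegree ≤ m → 0 < L (p * p))
    (P Q : ℝ[X]) (hP : P.Monic) (hPm : P.natDegree = m)
    (hPo : ∀ q : ℝ[X], q.degree < m → L (P * q) = 0)
    (hQ : Q.Monic) (hQm : Q.natDegree = m)
    (hQo : ∀ q : ℝ[X], q.degree < m → L (Q * q) = 0) : Q = P := by
  by_contra hne
  have hd : (Q - P).degree < m := by
    have h := degree_sub_lt (p := Q) (q := P)
      (by rw [degree_eq_natDegree hQ.ne_zero, degree_eq_natDegree hP.ne_zero, hQm, hPm])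
      hQ.ne_zero (by rw [hQ.leadingCoeff, hP.leadingCoeff])
    rwa [degree_eq_natDegree hQ.ne_zero, hQm] at h
  have h1 := hL (Q - P) (sub_ne_zero.2 hne) (natDegree_le_of_degree_le hd.le)
  have h2 := hPo _ hd
  have h3 := hQo _ hd
  rw [sub_mul, map_sub, h2, h3] at h1
  simp at h1

open Polynomial in
theorem cr_no_quad (m : ℕ) (L : ℝ[X] →ₗ[ℝ] ℝ)
    (hL : ∀ p : ℝ[X], p ≠ 0 → p.natDegree ≤ m → 0 < L (p * p))
    (P : ℝ[X]) (hP : P.Monic) (hPm : P.natDegree = m)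
    (hPo : ∀ q : ℝ[X], q.degree < m → L (P * q) = 0) (a b : ℝ)
    (hd : (X - C a) ^ 2 + C (b ^ 2) ∣ P) : False := by
  obtain ⟨W, hW⟩ := hd
  have hW0 : W ≠ 0 := by
    rintro rfl
    exact hP.ne_zero (by simpa using hW)
  have hq : ((X - C a) ^ 2 + C (b ^ 2) : ℝ[X]).natDegree = 2 := by
    rw [natDegree_add_C, natDegree_pow, natDegree_X_sub_C]
  have hq0 : ((X - C a) ^ 2 + C (b ^ 2) : ℝ[X]) ≠ 0 := by
    intro h
    rw [h] at hq
    simp at hq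
  have hdeg : 2 + W.natDegree = m := by
    rw [← hPm, hW, natDegree_mul hq0 hW0, hq]
  have h0 := hPo W (by
    rw [degree_eq_natDegree hW0]
    exact_mod_cast (by omega : W.natDegree < m))
  have h1 := hL W hW0 (by omega)
  have h2 := hL ((X - C a) * W) (mul_ne_zero (X_sub_C_ne_zero a) hW0) (by
    rw [natDegree_mul (X_sub_C_ne_zero a) hW0, natDegree_X_sub_C]; omega)
  have h3 : P * W = ((X - C a) * W) * ((X - C a) * W) + (b ^ 2) • (W * W) := by
    rw [hW, smul_eq_C_mul]; ring
  rw [h3, map_add, map_smul, smul_eq_mul] at h0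
  nlinarith [mul_nonneg (sq_nonneg b) h1.le]

open Polynomial in
theorem cr_roots (m : ℕ) (L : ℝ[X] →ₗ[ℝ] ℝ)
    (hL : ∀ p : ℝ[X], p ≠ 0 → p.natDegree ≤ m → 0 < L (p * p))
    (P : ℝ[X]) (hP : P.Monic) (hPm : P.natDegree = m)
    (hPo : ∀ q : ℝ[X], q.degree < m → L (P * q) = 0) :
    ∃ t : Fin m → ℝ, StrictMono t ∧ P = ∏ j, (X - C (t j)) := by
  have key := cr_no_quad m L hL P hP hPm hPo
  have hs : P.Splits := by
    rw [splits_iff_splits]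
    right
    intro g hg hgP
    obtain ⟨z, hz⟩ := IsAlgClosed.exists_aeval_eq_zero ℂ g (degree_pos_of_irreducible hg).ne'
    have hPz : aeval z P = 0 := by
      obtain ⟨w, rfl⟩ := hgP
      simp [hz]
    have him : z.im = 0 := by
      by_contra him
      have h := P.quadratic_dvd_of_aeval_eq_zero_im_ne_zero hPz him
      apply key z.re z.im
      convert h using 1
      rw [← Complex.normSq_eq_norm_sq, Complex.normSq_apply]
      simp only [map_add, map_mul, map_pow, map_ofNat]
      ring
    have hzr : z = ((z.re : ℝ) : ℂ) := by
      apply Complex.ext <;> simp [him]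
    apply degree_eq_one_of_irreducible_of_root hg (x := z.re)
    rw [hzr] at hz
    have h5 : aeval ((algebraMap ℝ ℂ) z.re) g = 0 := hz
    rw [aeval_algebraMap_apply] at h5
    simpa [IsRoot] using h5
  have hnd : P.roots.Nodup := by
    rw [Multiset.nodup_iff_count_le_one]
    intro a
    by_contra h
    rw [count_roots] at h
    apply key a 0
    have := pow_rootMultiplicity_dvd P a
    simpa using (pow_dvd_pow (X - C a) (by omega : 2 ≤ rootMultiplicity a P)).trans this
  have hcard : P.roots.toFinset.card = m := by
    rw [Multiset.toFinset_card_of_nodup hnd, ← hPm, hs.natDegree_eq_card_roots]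
  refine ⟨P.roots.toFinset.orderEmbOfFin hcard, OrderEmbedding.strictMono _, ?_⟩
  have h1 : P = (P.roots.map fun a => X - C a).prod := hs.eq_prod_roots_of_monic hP
  have h2 : (P.roots.map fun a => X - C a).prod = ∏ a ∈ P.roots.toFinset, (X - C a) := by
    rw [Finset.prod, Multiset.toFinset_val, hnd.dedup]
  refine (h1.trans h2).trans ?_
  generalize P.roots.toFinset = S at hcard ⊢
  have h3 := Finset.image_orderEmbOfFin_univ S hcard
  conv_lhs => rw [← h3]
  rw [Finset.prod_image]
  intro x _ y _ h
  exact (S.orderEmbOfFin hcard).injective h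

open Polynomial in
theorem cr_quadrature (m : ℕ) (L : ℝ[X] →ₗ[ℝ] ℝ)
    (P : ℝ[X]) (hP : P.Monic) (hPm : P.natDegree = m)
    (hPo : ∀ q : ℝ[X], q.degree < m → L (P * q) = 0)
    (t : Fin m → ℝ) (ht : StrictMono t) (hPt : P = ∏ j, (X - C (t j)))
    (f : ℝ[X]) (hf : f.degree < (2 * m : ℕ)) :
    L f = ∑ j, L (Lagrange.basis univ t j) * f.eval (t j) := by
  have hr : (f %ₘ P).degree < m := by
    have := degree_modByMonic_lt f hP
    rwa [degree_eq_natDegree hP.ne_zero, hPm] at this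
  have hq : (f /ₘ P).degree < m := by
    by_cases h0 : f /ₘ P = 0
    · rw [h0, degree_zero]; exact WithBot.bot_lt_coe _
    · rw [degree_eq_natDegree h0, natDegree_divByMonic f hP, hPm]
      have hf0 : f ≠ 0 := by rintro rfl; simp at h0
      rw [degree_eq_natDegree hf0] at hf
      have hf' : f.natDegree < 2 * m := by exact_mod_cast hf
      have : m ≠ 0 := by omega
      exact_mod_cast (by omega : f.natDegree - m < m)
  have hev : ∀ j, (f %ₘ P).eval (t j) = f.eval (t j) := by
    intro j
    have h : P.eval (t j) = 0 := by
      rw [hPt, eval_prod]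
      exact Finset.prod_eq_zero (Finset.mem_univ j) (by simp)
    conv_rhs => rw [← modByMonic_add_div f P]
    simp [h]
  have hint := Lagrange.eq_interpolate (s := univ) (v := t) (f := f %ₘ P)
    ht.injective.injOn (by simpa using hr)
  conv_lhs => rw [← modByMonic_add_div f P, map_add, hPo _ hq, add_zero, hint,
    Lagrange.interpolate_apply, map_sum]
  refine Finset.sum_congr rfl fun j _ => ?_
  rw [← smul_eq_C_mul, map_smul, smul_eq_mul, hev, mul_comm]

/-- The functional attached to the moment vector. -/
noncomputable def crL (N : ℕ) (c : Fin N → ℝ) : Polynomial ℝ →ₗ[ℝ] ℝ :=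
  ∑ k : Fin N, c k • Polynomial.lcoeff ℝ k

open Polynomial in
theorem crL_X_pow (N : ℕ) (c : Fin N → ℝ) (k : Fin N) : crL N c (X ^ (k : ℕ)) = c k := by
  simp [crL, coeff_X_pow, Fin.val_inj]

open Polynomial in
theorem crL_pos (n : ℕ) (hn : 2 ≤ n) (c : Fin (2 * n - 1) → ℝ) (hc : (hankel n c).PosDef)
    (p : ℝ[X]) (hp : p ≠ 0) (hpd : p.natDegree ≤ n - 1) : 0 < crL (2 * n - 1) c (p * p) := by
  have hp1 : p = ∑ i : Fin n, p.coeff i • X ^ (i : ℕ) := by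
    conv_lhs => rw [p.as_sum_range' n (by omega)]
    rw [Finset.sum_range]
    simp [← smul_X_eq_monomial]
  have hv : (fun i : Fin n => p.coeff i) ≠ 0 := by
    intro h
    apply hp
    rw [hp1]
    exact Finset.sum_eq_zero fun i _ => by rw [show p.coeff i = 0 from congrFun h i, zero_smul]
  have := hc.dotProduct_mulVec_pos hv
  refine lt_of_lt_of_eq this (Eq.symm ?_)
  conv_lhs => rw [hp1, Finset.sum_mul_sum]
  simp only [map_sum, dotProduct, Matrix.mulVec, Finset.mul_sum]
  refine Finset.sum_congr rfl fun i _ => Finset.sum_congr rfl fun j _ => ?_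
  have h := crL_X_pow (2 * n - 1) c
    ⟨(i : ℕ) + (j : ℕ), by have hi := i.isLt; have hj := j.isLt; omega⟩
  rw [smul_mul_smul_comm, ← pow_add, map_smul]
  simp only at h
  rw [h]
  simp [hankel]
  ring

open Polynomial in
theorem crL_eq_sum (n : ℕ) (c : Fin (2 * n - 1) → ℝ) (t σ : Fin (n - 1) → ℝ)
    (h : ∀ k : Fin (2 * n - 1), (k : ℕ) < 2 * n - 2 → c k = ∑ j, σ j * t j ^ (k : ℕ))
    (f : ℝ[X]) (hf : f.degree < (2 * (n - 1) : ℕ)) :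
    crL (2 * n - 1) c f = ∑ j, σ j * f.eval (t j) := by
  by_cases h0 : f = 0
  · simp [h0]
  have hd : f.natDegree < 2 * (n - 1) := by
    rw [degree_eq_natDegree h0] at hf
    exact_mod_cast hf
  have h1 := f.as_sum_range' _ hd
  have h2 : ∀ j, f.eval (t j) = ∑ k ∈ range (2 * (n - 1)), f.coeff k * t j ^ k := fun j =>
    eval_eq_sum_range' hd _
  simp only [h2, Finset.mul_sum]
  rw [Finset.sum_comm]
  conv_lhs => rw [h1, map_sum]
  refine Finset.sum_congr rfl fun k hk => ?_
  have hk' := Finset.mem_range.1 hk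
  have h3 := crL_X_pow (2 * n - 1) c ⟨k, by omega⟩
  have h4 := h ⟨k, by omega⟩ (by simp only; omega)
  simp only at h3 h4
  rw [← smul_X_eq_monomial, map_smul, h3, h4, smul_eq_mul, Finset.mul_sum]
  exact Finset.sum_congr rfl fun j _ => by ring

/-- **Theorem 3 (i).** Every point `c` in the interior of the moment cone (i.e. with
positive definite Hankel matrix `H(c)`) admits a canonical representation
`c_k = ∑ σ_j t_j^k` (for `k ≤ 2n-3`), `c_{2n-2} = ∑ σ_j t_j^{2n-2} + λ` with uniquely
determined roots `t_1 < … < t_{n-1}`, weights `σ_j > 0`, and mass `λ > 0` at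
infinity. -/
theorem canonical_representation_with_mass_at_infinity
    (n : ℕ) (hn : 2 ≤ n) (c : Fin (2 * n - 1) → ℝ) (hc : (hankel n c).PosDef) :
    ∃ (t σ : Fin (n - 1) → ℝ) (lam : ℝ),
      (StrictMono t ∧ (∀ j, 0 < σ j) ∧ 0 < lam ∧
        (∀ k : Fin (2 * n - 1), (k : ℕ) < 2 * n - 2 →
          c k = ∑ j, σ j * t j ^ (k : ℕ)) ∧
        c ⟨2 * n - 2, by omega⟩ = (∑ j, σ j * t j ^ (2 * n - 2)) + lam) ∧
      (∀ (t' σ' : Fin (n - 1) → ℝ) (lam' : ℝ),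
        StrictMono t' → (∀ j, 0 < σ' j) → 0 < lam' →
        (∀ k : Fin (2 * n - 1), (k : ℕ) < 2 * n - 2 →
          c k = ∑ j, σ' j * t' j ^ (k : ℕ)) →
        c ⟨2 * n - 2, by omega⟩ = (∑ j, σ' j * t' j ^ (2 * n - 2)) + lam' →
        t' = t ∧ σ' = σ ∧ lam' = lam) := by
  have hL := crL_pos n hn c hc
  have hX := crL_X_pow (2 * n - 1) c
  have hsum := crL_eq_sum n c
  set L := crL (2 * n - 1) c with hLdef
  obtain ⟨P, hP, hPm, hPo⟩ := cr_exists_orth (n - 1) L hL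
  obtain ⟨t, ht, hPt⟩ := cr_roots (n - 1) L hL P hP hPm hPo
  have hquad := cr_quadrature (n - 1) L P hP hPm hPo t ht hPt
  have hbas : ∀ j, (Lagrange.basis univ t j).natDegree = n - 2 := by
    intro j
    have h := Lagrange.degree_basis (s := univ) (v := t) ht.injective.injOn (Finset.mem_univ j)
    rw [Polynomial.natDegree_eq_of_degree_eq_some h]
    simp
    omega
  have hbas0 : ∀ j, Lagrange.basis univ t j ≠ 0 := fun j =>
    Lagrange.basis_ne_zero ht.injective.injOn (Finset.mem_univ j)
  have hbev : ∀ i j, (Lagrange.basis univ t j).eval (t i) = if i = j then 1 else 0 := by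
    intro i j
    split_ifs with h
    · subst h
      exact Lagrange.eval_basis_self ht.injective.injOn (Finset.mem_univ _)
    · exact Lagrange.eval_basis_of_ne (Ne.symm h) (Finset.mem_univ _)
  have hbdeg : ∀ j, (Lagrange.basis univ t j).degree < (2 * (n - 1) : ℕ) := by
    intro j
    rw [Polynomial.degree_eq_natDegree (hbas0 j), hbas]
    exact_mod_cast (by omega : n - 2 < 2 * (n - 1))
  have hPev : ∀ j, P.eval (t j) = 0 := by
    intro j
    rw [hPt, Polynomial.eval_prod]
    exact Finset.prod_eq_zero (Finset.mem_univ j) (by simp)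
  have hlast : L (Polynomial.X ^ (2 * n - 2)) = c ⟨2 * n - 2, by omega⟩ :=
    hX ⟨2 * n - 2, by omega⟩
  refine ⟨t, fun j => L (Lagrange.basis univ t j),
    c ⟨2 * n - 2, by omega⟩ - ∑ j, L (Lagrange.basis univ t j) * t j ^ (2 * n - 2),
    ⟨ht, ?_, ?_, ?_, by ring⟩, ?_⟩
  · intro j
    have h1 := hL _ (hbas0 j) (by rw [hbas]; omega)
    rw [hquad _ (by
      rw [Polynomial.degree_eq_natDegree (mul_ne_zero (hbas0 j) (hbas0 j)),
        Polynomial.natDegree_mul (hbas0 j) (hbas0 j), hbas]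
      exact_mod_cast (by omega : n - 2 + (n - 2) < 2 * (n - 1)))] at h1
    simpa [hbev] using h1
  · have h1 := hL P hP.ne_zero hPm.le
    have hPP : (P * P).Monic := hP.mul hP
    have hPPd : (P * P).natDegree = 2 * n - 2 := by
      rw [hP.natDegree_mul hP, hPm]; omega
    have h2 : (P * P - Polynomial.X ^ (2 * n - 2)).degree < ((2 * (n - 1) : ℕ) : WithBot ℕ) := by
      have h := Polynomial.degree_sub_lt (p := P * P) (q := Polynomial.X ^ (2 * n - 2))
        (by rw [Polynomial.degree_eq_natDegree hPP.ne_zero, hPPd, Polynomial.degree_X_pow])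
        hPP.ne_zero (by rw [hPP.leadingCoeff, (Polynomial.monic_X_pow _).leadingCoeff])
      rw [Polynomial.degree_eq_natDegree hPP.ne_zero, hPPd] at h
      rwa [show 2 * n - 2 = 2 * (n - 1) by omega] at h ⊢
    have h3 := hquad _ h2
    rw [map_sub, hlast] at h3
    simp only [Polynomial.eval_sub, Polynomial.eval_mul, hPev, Polynomial.eval_pow,
      Polynomial.eval_X, mul_zero, zero_sub, mul_neg, Finset.sum_neg_distrib] at h3
    linarith
  · intro k hk
    rw [← hX k, hquad _ (by
      rw [Polynomial.degree_X_pow]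
      exact_mod_cast (by omega : (k : ℕ) < 2 * (n - 1)))]
    simp
  · intro t' σ' lam' ht' hσ' hlam' hk' hl'
    have hs' := hsum t' σ' hk'
    have hQ : (∏ j, (Polynomial.X - Polynomial.C (t' j))).Monic :=
      Polynomial.monic_prod_of_monic _ _ fun j _ => Polynomial.monic_X_sub_C _
    have hQm : (∏ j, (Polynomial.X - Polynomial.C (t' j))).natDegree = n - 1 := by
      rw [Polynomial.natDegree_finset_prod_X_sub_C_eq_card]; simp
    have hQP := cr_unique_orth (n - 1) L hL P _ hP hPm hPo hQ hQm (by
      intro q hq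
      rw [hs']
      · refine Finset.sum_eq_zero fun j _ => ?_
        rw [Polynomial.eval_mul, Polynomial.eval_prod,
          Finset.prod_eq_zero (Finset.mem_univ j) (by simp)]
        simp
      · by_cases hq0 : q = 0
        · rw [hq0, mul_zero, Polynomial.degree_zero]; exact WithBot.bot_lt_coe _
        · rw [Polynomial.degree_eq_natDegree hq0] at hq
          have hq' : q.natDegree < n - 1 := by exact_mod_cast hq
          rw [Polynomial.degree_eq_natDegree (mul_ne_zero hQ.ne_zero hq0),
            Polynomial.natDegree_mul hQ.ne_zero hq0, hQm]
          exact_mod_cast (by omega : n - 1 + q.natDegree < 2 * (n - 1)))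
    have hroots : ∀ (s : Fin (n - 1) → ℝ) (x : ℝ),
        (∏ j, (Polynomial.X - Polynomial.C (s j))).eval x = 0 ↔ x ∈ Set.range s := by
      intro s x
      rw [Polynomial.eval_prod, Finset.prod_eq_zero_iff]
      simp [sub_eq_zero, eq_comm]
    have htt : t' = t := by
      rw [← ht'.range_inj ht]
      ext x
      rw [← hroots t' x, ← hroots t x, hQP, ← hPt]
    subst htt
    have hσσ : σ' = fun j => L (Lagrange.basis univ t' j) := by
      funext j
      rw [hs' _ (hbdeg j)]
      simp [hbev]
    refine ⟨rfl, hσσ, ?_⟩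
    rw [hl', hσσ]
    ring
end
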